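/- arXiv:math/0412345 — 10 statements merged into one kernel-verified Lean document; each statement's English description precedes it below -/
import Mathlib

section
/- Let f be a probability density on ℝ with finite second moment, let b ∈ ℝ, and let g, h : ℝ → ℝ be measurable functions such that h represents g under f and such that for every θ ∈ ℝ the function x ↦ g(x+θ) is integrable against the density x ↦ f(x−b). Then the function h + b·g represents g under the translated density x ↦ f(x−b). -/
open MeasureTheory

/-- `h` represents `g` under the density `f`: for every `θ ∈ ℝ` the integrals
`∫ h(x+θ) f(x) dx` and `∫ x g(x+θ) f(x) dx` are absolutely convergent and equal. -/
def Represents (f g h : ℝ → ℝ) : Prop :=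
  ∀ θ : ℝ,
    Integrable (fun x => h (x + θ) * f x) ∧
    Integrable (fun x => x * g (x + θ) * f x) ∧
    ∫ x : ℝ, h (x + θ) * f x = ∫ x : ℝ, x * g (x + θ) * f x

theorem stein_translation_of_density
    (f g h : ℝ → ℝ) (b : ℝ)
    (hf_meas : Measurable f) (hf_nonneg : ∀ x, 0 ≤ f x)
    (hf_prob : ∫ x : ℝ, f x = 1)
    (hf_mom2 : Integrable (fun x => x ^ 2 * f x))
    (hg_meas : Measurable g) (hh_meas : Measurable h)
    (hrep : Represents f g h)
    (hg_int : ∀ θ : ℝ, Integrable (fun x => g (x + θ) * f (x - b))) :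
    Represents (fun x => f (x - b)) g (fun x => h x + b * g x) := by
  intro θ
  obtain ⟨h_int, g_int, heq⟩ := hrep (θ + b)
  have shift : ∀ x : ℝ, x - b + (θ + b) = x + θ := fun x => by ring
  have h_int' : Integrable (fun x => h (x + θ) * f (x - b)) := by
    simpa only [shift] using h_int.comp_sub_right b
  have g_int' : Integrable (fun x => (x - b) * g (x + θ) * f (x - b)) := by
    simpa only [shift] using g_int.comp_sub_right b
  have heq' : ∫ x, h (x + θ) * f (x - b) = ∫ x, (x - b) * g (x + θ) * f (x - b) := by
    rw [← integral_sub_right_eq_self _ b, ← integral_sub_right_eq_self (fun x => x * _ * _) b] at heq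
    simpa only [shift] using heq
  have b_int : Integrable (fun x => b * (g (x + θ) * f (x - b))) := (hg_int θ).const_mul b
  have hsplit : (fun x => (h (x + θ) + b * g (x + θ)) * f (x - b)) =
      fun x => h (x + θ) * f (x - b) + b * (g (x + θ) * f (x - b)) := by
    funext x; ring
  have gsplit : (fun x => x * g (x + θ) * f (x - b)) =
      fun x => (x - b) * g (x + θ) * f (x - b) + b * (g (x + θ) * f (x - b)) := by
    funext x; ring
  refine ⟨?_, ?_, ?_⟩
  · rw [hsplit]
    exact h_int'.add b_int
  · rw [gsplit]
    exact g_int'.add b_int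
  · rw [hsplit, gsplit, integral_add h_int' b_int, integral_add g_int' b_int, heq']
end

section
/- Let M be a finite positive Borel measure on ℝ with M({0}) = 0, and let f be a probability density on ℝ whose characteristic function is f̂(t) = exp( ∫_ℝ (e^{ixt} − 1 − ixt)/x² M(dx) ) (so f is infinitely divisible with zero mean and finite second moment). Let g : ℝ → ℝ be Lipschitz, and define K(g)(t) := ∫_ℝ (g(t+x) − g(t))/x M(dx). Then for every θ ∈ ℝ, ∫_ℝ K(g)(x+θ) f(x) dx = ∫_ℝ x g(x+θ) f(x) dx. -/
open MeasureTheory Complex Filter Topology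

/-- The multiplicative convolution of `N` with the uniform distribution on `[0, 1]`. -/
noncomputable def uniformScaling (N : Measure ℝ) : Measure ℝ :=
  (N.prod (volume.restrict (Set.Ioc (0 : ℝ) 1))).map (fun p => p.1 * p.2)

instance (N : Measure ℝ) [IsFiniteMeasure N] : IsFiniteMeasure (uniformScaling N) := by
  unfold uniformScaling; infer_instance

theorem integral_uniformScaling {E : Type*} [NormedAddCommGroup E] [NormedSpace ℝ E]
    (N : Measure ℝ) [IsFiniteMeasure N] {h : ℝ → E} (hm : StronglyMeasurable h) {C : ℝ}
    (hC : ∀ x, ‖h x‖ ≤ C) :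
    ∫ z, h z ∂uniformScaling N = ∫ y, (∫ u in (0 : ℝ)..1, h (y * u)) ∂N := by
  have hmul : Measurable fun p : ℝ × ℝ => p.1 * p.2 := by fun_prop
  unfold uniformScaling
  rw [integral_map hmul.aemeasurable hm.aestronglyMeasurable, integral_prod]
  · simp_rw [intervalIntegral.integral_of_le zero_le_one]
  · exact Integrable.of_bound (hm.comp_measurable hmul).aestronglyMeasurable C
      (Eventually.of_forall fun p => hC _)

theorem integral_conv_of_bounded {E : Type*} [NormedAddCommGroup E] [NormedSpace ℝ E]
    (μ ν : Measure ℝ) [IsFiniteMeasure μ] [IsFiniteMeasure ν] {h : ℝ → E}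
    (hm : StronglyMeasurable h) {C : ℝ} (hC : ∀ x, ‖h x‖ ≤ C) :
    ∫ z, h z ∂(μ.conv ν) = ∫ x, ∫ y, h (x + y) ∂ν ∂μ := by
  have hadd : Measurable fun p : ℝ × ℝ => p.1 + p.2 := by fun_prop
  unfold Measure.conv
  rw [integral_map hadd.aemeasurable hm.aestronglyMeasurable, integral_prod]
  exact Integrable.of_bound (hm.comp_measurable hadd).aestronglyMeasurable C
      (Eventually.of_forall fun p => hC _)

theorem LipschitzWith.integral_deriv_comp_add_mul {g : ℝ → ℝ} {L : NNReal}
    (hg : LipschitzWith L g) (x : ℝ) {y : ℝ} (hy : y ≠ 0) :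
    ∫ u in (0 : ℝ)..1, deriv g (x + y * u) = (g (x + y) - g x) / y := by
  rw [intervalIntegral.integral_comp_add_mul _ hy,
    AbsolutelyContinuousOnInterval.integral_deriv_eq_sub
      (hg.lipschitzOnWith.absolutelyContinuousOnInterval)]
  simp [div_eq_inv_mul]

theorem LipschitzWith.integral_deriv_uniformScaling {g : ℝ → ℝ} {L : NNReal}
    (hg : LipschitzWith L g) (N : Measure ℝ) [IsFiniteMeasure N] (hN : N {0} = 0) (x : ℝ) :
    ∫ z, deriv g (x + z) ∂uniformScaling N = ∫ y, (g (x + y) - g x) / y ∂N := by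
  rw [integral_uniformScaling N (h := fun z => deriv g (x + z)) (C := L)
    ((measurable_deriv g).comp (measurable_const_add x)).stronglyMeasurable
    (fun _ => norm_deriv_le_of_lipschitz hg)]
  have hN0 : ∀ᵐ y ∂N, y ≠ 0 := by simpa [ae_iff] using hN
  refine integral_congr_ae ?_
  filter_upwards [hN0] with y hy using hg.integral_deriv_comp_add_mul x hy

theorem charFun_uniformScaling (N : Measure ℝ) [IsFiniteMeasure N] (hN : N {0} = 0)
    {t : ℝ} (ht : t ≠ 0) :
    charFun (uniformScaling N) t = (I * t)⁻¹ * ∫ y, (exp (I * y * t) - 1) / y ∂N := by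
  rw [charFun_apply_real, integral_uniformScaling N (C := 1) (by fun_prop)
    (fun x => by rw [← ofReal_mul, norm_exp_ofReal_mul_I]), ← integral_const_mul]
  have hN0 : ∀ᵐ y ∂N, y ≠ 0 := by simpa [ae_iff] using hN
  refine integral_congr_ae ?_
  filter_upwards [hN0] with y hy
  have hc : (I * y * t : ℂ) ≠ 0 := by simp [hy, ht]
  have := integral_exp_mul_complex (a := 0) (b := 1) hc
  have e : ∀ u : ℝ, exp (t * ((y * u : ℝ) : ℂ) * I) = exp (I * y * t * u) := by
    intro u; push_cast; ring_nf
  simp_rw [e, this]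
  have : (y : ℂ) ≠ 0 := by exact_mod_cast hy
  have : (t : ℂ) ≠ 0 := by exact_mod_cast ht
  simp
  field_simp
  simp

theorem norm_exp_I_mul_mul_sub_one_sub_le (x t : ℝ) :
    ‖exp (I * x * t) - 1 - I * x * t‖ ≤ 3 * (x * t) ^ 2 := by
  have hn : ‖I * x * t‖ = |x * t| := by simp [abs_mul]
  have he : I * x * t = I * ((x * t : ℝ) : ℂ) := by push_cast; ring
  rcases le_total |x * t| 1 with h | h
  · have := norm_exp_sub_one_sub_id_le (x := I * x * t) (by rwa [hn])
    rw [hn, sq_abs] at this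
    nlinarith [sq_nonneg (x * t)]
  · have h1 : ‖exp (I * x * t) - 1‖ ≤ |x * t| := by
      rw [he]; exact Real.norm_exp_I_mul_ofReal_sub_one_le
    have := norm_sub_le (exp (I * x * t) - 1) (I * x * t)
    rw [hn] at this
    nlinarith [sq_abs (x * t)]

theorem norm_exp_sub_one_sub_div_sq_le (x t : ℝ) :
    ‖(exp (I * x * t) - 1 - I * x * t) / (x : ℂ) ^ 2‖ ≤ 3 * t ^ 2 := by
  rcases eq_or_ne x 0 with rfl | hx
  · simp; positivity
  · rw [norm_div, norm_pow, norm_real, Real.norm_eq_abs, sq_abs, div_le_iff₀ (by positivity)]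
    linarith [norm_exp_I_mul_mul_sub_one_sub_le x t]

theorem hasDerivAt_levyExponent (M : Measure ℝ) [IsFiniteMeasure M] (t : ℝ) :
    HasDerivAt (fun t : ℝ => ∫ x : ℝ, (exp (I * x * t) - 1 - I * x * t) / (x : ℂ) ^ 2 ∂M)
      (I * ∫ y, (exp (I * y * t) - 1) / y ∂M) t := by
  rw [← integral_const_mul]
  refine (hasDerivAt_integral_of_dominated_loc_of_deriv_le (μ := M) (𝕜 := ℝ)
    (F := fun t x => (exp (I * x * t) - 1 - I * x * t) / (x : ℂ) ^ 2)
    (F' := fun t x => I * ((exp (I * x * t) - 1) / x)) (bound := fun _ => |t| + 1)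
    (Metric.ball_mem_nhds t one_pos) ?_ ?_ ?_ ?_ (integrable_const _) ?_).2
  · exact Eventually.of_forall fun t => Measurable.aestronglyMeasurable (by fun_prop)
  · exact Integrable.of_bound (Measurable.aestronglyMeasurable (by fun_prop)) (3 * t ^ 2)
      (Eventually.of_forall fun x => norm_exp_sub_one_sub_div_sq_le x t)
  · exact Measurable.aestronglyMeasurable (by fun_prop)
  · refine Eventually.of_forall fun x s hs => ?_
    have hs' : |s| ≤ |t| + 1 := by
      rw [Metric.mem_ball, Real.dist_eq] at hs
      have := abs_sub_abs_le_abs_sub s t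
      linarith
    refine le_trans ?_ hs'
    rcases eq_or_ne x 0 with rfl | hx
    · simp
    have h1 : ‖exp (I * x * s) - 1‖ ≤ |x * s| := by
      rw [mul_assoc, ← ofReal_mul]; exact Real.norm_exp_I_mul_ofReal_sub_one_le
    rw [norm_mul, norm_I, one_mul, norm_div, norm_real, Real.norm_eq_abs,
      div_le_iff₀ (abs_pos.2 hx)]
    rwa [abs_mul, mul_comm |x|] at h1
  · refine Eventually.of_forall fun x s _ => ?_
    have h0 : HasDerivAt (fun s : ℝ => I * x * (s : ℂ)) (I * x) s := by
      simpa using (ofRealCLM.hasDerivAt (x := s)).const_mul (I * x)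
    refine (((h0.cexp.sub_const 1).sub h0).div_const _).congr_deriv ?_
    rcases eq_or_ne x 0 with rfl | hx
    · simp
    have : (x : ℂ) ≠ 0 := by exact_mod_cast hx
    field_simp

theorem memLp_two_of_charFun_bound (μ : Measure ℝ) [IsProbabilityMeasure μ] (C : ℝ)
    (h : ∀ᶠ t in 𝓝[≠] (0 : ℝ), ‖1 - charFun μ t‖ ≤ C * t ^ 2) : MemLp id 2 μ := by
  have hlim : ∀ x : ℝ, Tendsto (fun t : ℝ => ENNReal.ofReal ((1 - Real.cos (t * x)) / t ^ 2))
      (𝓝[≠] 0) (𝓝 (ENNReal.ofReal (x ^ 2 / 2))) := by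
    intro x
    refine ENNReal.tendsto_ofReal ?_
    have hd : HasDerivAt (fun t : ℝ => Real.sin (t * (x / 2))) (x / 2) 0 := by
      simpa using ((hasDerivAt_id (0 : ℝ)).mul_const (x / 2)).sin
    have := ((hasDerivAt_iff_tendsto_slope_zero.1 hd).pow 2).const_mul 2
    convert this using 2 with t
    · have := Real.cos_sq (t * (x / 2))
      rw [show 2 * (t * (x / 2)) = t * x by ring] at this
      simp only [zero_add, zero_mul, Real.sin_zero, sub_zero, smul_eq_mul]
      rw [mul_pow, Real.sin_sq, this, inv_pow, div_eq_inv_mul]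
      ring
    · ring
  have hF := lintegral_liminf_le (μ := μ) (u := 𝓝[≠] (0 : ℝ))
    (f := fun t x => ENNReal.ofReal ((1 - Real.cos (t * x)) / t ^ 2)) (fun t => by fun_prop)
  simp_rw [fun x => (hlim x).liminf_eq] at hF
  have hb : ∀ᶠ t in 𝓝[≠] (0 : ℝ),
      ∫⁻ x, ENNReal.ofReal ((1 - Real.cos (t * x)) / t ^ 2) ∂μ ≤ ENNReal.ofReal C := by
    filter_upwards [h, self_mem_nhdsWithin] with t ht ht0
    have ht0 : 0 < t ^ 2 := sq_pos_of_ne_zero ht0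
    have hint : Integrable (fun x : ℝ => exp (t * x * I)) μ :=
      Integrable.of_bound (by fun_prop) 1
        (Eventually.of_forall fun x => by rw [← ofReal_mul, norm_exp_ofReal_mul_I])
    have hre : (1 - charFun μ t).re = ∫ x, (1 - Real.cos (t * x)) ∂μ := by
      rw [charFun_apply_real, sub_re, one_re, integral_sub (integrable_const _)
        (Integrable.of_bound (by fun_prop) 1 (Eventually.of_forall fun x => Real.abs_cos_le_one _))]
      have := integral_re hint
      simp only [RCLike.re_eq_complex_re] at this
      rw [← this]
      simp [← ofReal_mul, exp_ofReal_mul_I_re]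
    rw [← ofReal_integral_eq_lintegral_ofReal]
    · refine ENNReal.ofReal_le_ofReal ?_
      rw [integral_div, ← hre, div_le_iff₀ ht0]
      exact (re_le_norm _).trans ht
    · refine Integrable.of_bound (by fun_prop) (2 / t ^ 2) (Eventually.of_forall fun x => ?_)
      rw [norm_div, Real.norm_eq_abs, Real.norm_eq_abs, abs_of_pos ht0]
      gcongr
      rw [abs_le]; constructor <;> linarith [Real.cos_le_one (t * x), Real.neg_one_le_cos (t * x)]
    · exact Eventually.of_forall fun x =>
        div_nonneg (by simpa using Real.cos_le_one (t * x)) ht0.le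
  have hfin : ∫⁻ x, ENNReal.ofReal (x ^ 2 / 2) ∂μ < ⊤ :=
    (hF.trans (liminf_le_of_frequently_le' hb.frequently)).trans_lt ENNReal.ofReal_lt_top
  rw [memLp_two_iff_integrable_sq (by fun_prop)]
  have hI : Integrable (fun x : ℝ => x ^ 2 / 2) μ := by
    refine ⟨by fun_prop, ?_⟩
    rw [hasFiniteIntegral_iff_ofReal (Eventually.of_forall fun x => by positivity)]
    exact hfin
  simpa using hI.mul_const 2

section LevyKhintchine

variable {M μ : Measure ℝ} [IsFiniteMeasure M] [IsProbabilityMeasure μ]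

theorem memLp_two_of_charFun_eq
    (h : ∀ t : ℝ, charFun μ t =
      exp (∫ x : ℝ, (exp (I * x * t) - 1 - I * x * t) / (x : ℂ) ^ 2 ∂M)) : MemLp id 2 μ := by
  set ψ : ℝ → ℂ := fun t => ∫ x : ℝ, (exp (I * x * t) - 1 - I * x * t) / (x : ℂ) ^ 2 ∂M with hψ
  have hb : ∀ t, ‖ψ t‖ ≤ 3 * t ^ 2 * M.real Set.univ := fun t =>
    norm_integral_le_of_norm_le_const
      (Eventually.of_forall fun x => norm_exp_sub_one_sub_div_sq_le x t)
  have h0 : ψ 0 = 0 := by simp [hψ]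
  have hc : Tendsto ψ (𝓝 0) (𝓝 0) := by
    simpa [h0] using! (hasDerivAt_levyExponent M 0).continuousAt.tendsto
  refine memLp_two_of_charFun_bound μ (6 * M.real Set.univ) (nhdsWithin_le_nhds ?_)
  filter_upwards [hc (Metric.closedBall_mem_nhds 0 one_pos)] with t ht
  have := norm_exp_sub_one_le (x := ψ t) (by simpa using ht)
  rw [h t, norm_sub_rev]
  linarith [hb t]

theorem integral_mul_exp_of_charFun_eq
    (h : ∀ t : ℝ, charFun μ t =
      exp (∫ x : ℝ, (exp (I * x * t) - 1 - I * x * t) / (x : ℂ) ^ 2 ∂M)) (t : ℝ) :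
    ∫ x : ℝ, x * exp (t * x * I) ∂μ = charFun μ t * ∫ y, (exp (I * y * t) - 1) / y ∂M := by
  have h1 : MemLp id (1 : ℕ) μ := by
    simpa using! (memLp_two_of_charFun_eq h).mono_exponent one_le_two
  have h2 := iteratedDeriv_charFun (t := t) h1
  have h3 := (hasDerivAt_levyExponent M t).cexp
  rw [← h t, ← funext h] at h3
  rw [iteratedDeriv_one, h3.deriv] at h2
  simp only [pow_one] at h2
  apply mul_left_cancel₀ I_ne_zero
  rw [← h2]; ring

theorem integrable_id_of_charFun_eq
    (h : ∀ t : ℝ, charFun μ t =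
      exp (∫ x : ℝ, (exp (I * x * t) - 1 - I * x * t) / (x : ℂ) ^ 2 ∂M)) :
    Integrable (fun x => x) μ :=
  (memLp_two_of_charFun_eq h).integrable one_le_two

theorem integral_id_of_charFun_eq
    (h : ∀ t : ℝ, charFun μ t =
      exp (∫ x : ℝ, (exp (I * x * t) - 1 - I * x * t) / (x : ℂ) ^ 2 ∂M)) :
    ∫ x, x ∂μ = 0 := by
  have := integral_mul_exp_of_charFun_eq h 0
  simp only [ofReal_zero, zero_mul, exp_zero, mul_one, mul_zero, sub_self, zero_div,
    integral_zero] at this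
  rw [integral_complex_ofReal] at this
  exact_mod_cast this

/-- The measure `x ^ 2 μ(dx)`. -/
noncomputable def sqDensity (μ : Measure ℝ) : Measure ℝ :=
  μ.withDensity fun x => ENNReal.ofReal (x ^ 2)

theorem integral_sqDensity {E : Type*} [NormedAddCommGroup E] [NormedSpace ℝ E]
    (μ : Measure ℝ) (h : ℝ → E) : ∫ x, h x ∂sqDensity μ = ∫ x, x ^ 2 • h x ∂μ := by
  rw [sqDensity, integral_withDensity_eq_integral_toReal_smul (by fun_prop)
    (Eventually.of_forall fun x => ENNReal.ofReal_lt_top)]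
  simp [ENNReal.toReal_ofReal, sq_nonneg]

theorem sqDensity_singleton_zero (μ : Measure ℝ) : sqDensity μ {0} = 0 := by
  simp [sqDensity]

theorem isFiniteMeasure_sqDensity {μ : Measure ℝ} (h : MemLp id 2 μ) :
    IsFiniteMeasure (sqDensity μ) :=
  isFiniteMeasure_withDensity_ofReal h.integrable_sq.2

/-- The zero-bias identity in measure form. -/
theorem conv_uniformScaling_eq (hM0 : M {0} = 0)
    (h : ∀ t : ℝ, charFun μ t =
      exp (∫ x : ℝ, (exp (I * x * t) - 1 - I * x * t) / (x : ℂ) ^ 2 ∂M)) :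
    μ.conv (uniformScaling M) = uniformScaling (sqDensity μ) := by
  have := isFiniteMeasure_sqDensity (memLp_two_of_charFun_eq h)
  refine Measure.ext_of_charFun (Continuous.ext_on (dense_compl_singleton (0 : ℝ))
    continuous_charFun continuous_charFun fun t ht => ?_)
  have ht : t ≠ 0 := ht
  rw [charFun_conv, charFun_uniformScaling M hM0 ht,
    charFun_uniformScaling _ (sqDensity_singleton_zero μ) ht, integral_sqDensity, mul_left_comm,
    ← integral_mul_exp_of_charFun_eq h t]
  congr 1
  have hi := integrable_id_of_charFun_eq h
  have e : ∀ x : ℝ, x ^ 2 • ((exp (I * x * t) - 1) / (x : ℂ)) =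
      x * exp (t * x * I) - (x : ℂ) := by
    intro x
    rcases eq_or_ne x 0 with rfl | hx
    · simp
    have : (x : ℂ) ≠ 0 := by exact_mod_cast hx
    rw [real_smul, show I * x * t = t * x * I by ring]
    push_cast
    field_simp
  simp_rw [e]
  rw [integral_sub _ hi.ofReal, integral_complex_ofReal, integral_id_of_charFun_eq h,
    ofReal_zero, sub_zero]
  exact hi.ofReal.mul_bdd (c := 1) (by fun_prop)
    (Eventually.of_forall fun x => by rw [← ofReal_mul, norm_exp_ofReal_mul_I])

theorem stein_identity_of_charFun_eq (hM0 : M {0} = 0)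
    (h : ∀ t : ℝ, charFun μ t =
      exp (∫ x : ℝ, (exp (I * x * t) - 1 - I * x * t) / (x : ℂ) ^ 2 ∂M))
    {g : ℝ → ℝ} {L : NNReal} (hg : LipschitzWith L g) :
    ∫ x : ℝ, (∫ y : ℝ, (g (x + y) - g x) / y ∂M) ∂μ = ∫ x : ℝ, x * g x ∂μ := by
  have hL := memLp_two_of_charFun_eq h
  have hi := integrable_id_of_charFun_eq h
  have := isFiniteMeasure_sqDensity hL
  have h1 := hg.integral_deriv_uniformScaling (sqDensity μ) (sqDensity_singleton_zero μ) 0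
  simp_rw [← hg.integral_deriv_uniformScaling M hM0]
  rw [← integral_conv_of_bounded μ _ (measurable_deriv g).stronglyMeasurable
    (fun _ => norm_deriv_le_of_lipschitz hg), conv_uniformScaling_eq hM0 h]
  simp only [zero_add] at h1
  rw [h1, integral_sqDensity]
  have e : ∀ x : ℝ, x ^ 2 • ((g x - g 0) / x) = x * (g x - g 0) := by
    intro x
    rcases eq_or_ne x 0 with rfl | hx
    · simp
    rw [smul_eq_mul]; field_simp
  have hint : Integrable (fun x => x * (g x - g 0)) μ := by
    refine (hL.integrable_sq.const_mul L).mono'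
      (measurable_id.mul (hg.continuous.measurable.sub_const _)).aestronglyMeasurable
      (Eventually.of_forall fun x => ?_)
    have := hg.dist_le_mul x 0
    rw [Real.dist_eq, Real.dist_eq, sub_zero] at this
    rw [Real.norm_eq_abs, abs_mul, id, ← sq_abs]
    nlinarith [abs_nonneg x]
  simp_rw [e]
  calc ∫ x, x * (g x - g 0) ∂μ = ∫ x, x * (g x - g 0) ∂μ + ∫ x, x * g 0 ∂μ := by
        rw [integral_mul_const, integral_id_of_charFun_eq h]; simp
    _ = ∫ x, x * g x ∂μ := by
        rw [← integral_add hint (hi.mul_const _)]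
        congr with x; ring

end LevyKhintchine

theorem stein_identity_infinitely_divisible
    (M : Measure ℝ) [IsFiniteMeasure M] (hM0 : M {0} = 0)
    (f : ℝ → ℝ) (hf_meas : Measurable f) (hf_nonneg : ∀ x, 0 ≤ f x)
    (hf_prob : ∫ x : ℝ, f x = 1)
    (hchar : ∀ t : ℝ,
      (∫ x : ℝ, Complex.exp (Complex.I * x * t) * (f x : ℂ)) =
        Complex.exp (∫ x : ℝ,
          (Complex.exp (Complex.I * x * t) - 1 - Complex.I * x * t) / (x : ℂ) ^ 2 ∂M))
    (g : ℝ → ℝ) (L : NNReal) (hg : LipschitzWith L g) (θ : ℝ) :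
    ∫ x : ℝ, (∫ y : ℝ, (g (x + θ + y) - g (x + θ)) / y ∂M) * f x =
      ∫ x : ℝ, x * g (x + θ) * f x := by
  have hfi : Integrable f := by
    by_contra hn
    simp [integral_undef hn] at hf_prob
  set μ : Measure ℝ := volume.withDensity fun x => ENNReal.ofReal (f x) with hμ
  have hμp : IsProbabilityMeasure μ := by
    constructor
    rw [hμ, withDensity_apply _ MeasurableSet.univ, setLIntegral_univ,
      ← ofReal_integral_eq_lintegral_ofReal hfi (Eventually.of_forall hf_nonneg), hf_prob,
      ENNReal.ofReal_one]
  have hμi : ∀ {E : Type} [NormedAddCommGroup E] [NormedSpace ℝ E] (k : ℝ → E),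
      ∫ x, k x ∂μ = ∫ x, f x • k x := fun k => by
    rw [hμ, integral_withDensity_eq_integral_toReal_smul (by fun_prop)
      (Eventually.of_forall fun x => ENNReal.ofReal_lt_top)]
    simp [ENNReal.toReal_ofReal, hf_nonneg]
  have hc : ∀ t : ℝ, charFun μ t =
      exp (∫ x : ℝ, (exp (I * x * t) - 1 - I * x * t) / (x : ℂ) ^ 2 ∂M) := by
    intro t
    rw [← hchar t, charFun_apply_real, hμi]
    congr with x
    rw [real_smul, show I * x * t = t * x * I by ring, mul_comm]
  have hgθ : LipschitzWith L fun x => g (x + θ) := by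
    simpa using! hg.comp (isometry_add_right θ).lipschitz
  have := stein_identity_of_charFun_eq hM0 hc hgθ
  rw [hμi, hμi] at this
  simpa only [smul_eq_mul, mul_comm, mul_left_comm, mul_assoc, add_right_comm] using this
end

section
/- Let M be a finite positive Borel measure on ℝ with M({0}) = 0, and let g : ℝ → ℝ be Lipschitz with compact support. Then the functions y ↦ ∫_ℝ |g(y+x) − g(y)|/|x| M(dx) and K(g)(y) := ∫_ℝ (g(y+x) − g(y))/x M(dx) belong to L¹(ℝ), and the Fourier transform of K(g) satisfies, for every t ∈ ℝ, ∫_ℝ K(g)(y) e^{ity} dy = ĝ(t) · ∫_ℝ (e^{−ixt} − 1)/x M(dx), where ĝ(t) = ∫_ℝ g(y) e^{ity} dy. -/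
open MeasureTheory Complex

/-- Pointwise bound of a difference quotient of a Lipschitz function vanishing outside
`[-R, R]` by a function whose integral in `y` does not depend on `x`. -/
lemma abs_diffQuotient_le {g : ℝ → ℝ} {L : NNReal} (hg : LipschitzWith L g) {R : ℝ}
    (hR : ∀ y, R < |y| → g y = 0) (y x : ℝ) :
    |(g (y + x) - g y) / x| ≤
      (Set.Icc (-(R + 1)) (R + 1)).indicator (fun _ => (L : ℝ)) y + |g (y + x)| + |g y| := by
  have hL : |g (y + x) - g y| ≤ L * |x| := by
    simpa [Real.dist_eq] using hg.dist_le_mul (y + x) y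
  have hind : 0 ≤ (Set.Icc (-(R + 1)) (R + 1)).indicator (fun _ => (L : ℝ)) y :=
    Set.indicator_nonneg (fun _ _ => L.coe_nonneg) y
  rw [abs_div]
  rcases le_or_gt |x| 1 with hx | hx
  · by_cases hy : y ∈ Set.Icc (-(R + 1)) (R + 1)
    · rw [Set.indicator_of_mem hy]
      have : |g (y + x) - g y| / |x| ≤ L :=
        div_le_of_le_mul₀ (abs_nonneg x) L.coe_nonneg hL
      linarith [abs_nonneg (g (y + x)), abs_nonneg (g y)]
    · have hy' : R + 1 < |y| := by
        rw [Set.mem_Icc, ← abs_le] at hy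
        exact not_le.mp hy
      have hyx : R < |y + x| := by
        have := abs_sub_abs_le_abs_sub y (-x)
        rw [abs_neg, sub_neg_eq_add] at this
        linarith
      rw [hR y (by linarith), hR (y + x) hyx]
      simpa using hind
  · have : |g (y + x) - g y| / |x| ≤ |g (y + x) - g y| := div_le_self (abs_nonneg _) hx.le
    linarith [abs_sub (g (y + x)) (g y)]

/-- The difference quotients of a compactly supported Lipschitz function are jointly integrable
in the base point and the increment, for any finite measure on the increments. -/
lemma integrable_diffQuotient_prod (M : Measure ℝ) [IsFiniteMeasure M]
    {g : ℝ → ℝ} {L : NNReal} (hg : LipschitzWith L g) (hsupp : HasCompactSupport g) :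
    Integrable (fun p : ℝ × ℝ => (g (p.1 + p.2) - g p.1) / p.2) (volume.prod M) := by
  obtain ⟨R, hR⟩ := hsupp.isCompact.isBounded.exists_norm_le
  have hR' : ∀ y, R < |y| → g y = 0 := fun y hy => by
    by_contra h
    exact absurd (hR y (subset_tsupport g h)) (not_le.mpr hy)
  have hgc : Continuous g := hg.continuous
  have hgi : Integrable g := hgc.integrable_of_hasCompactSupport hsupp
  have hshift : Integrable (fun p : ℝ × ℝ => |g (p.1 + p.2)|) (volume.prod M) := by
    rw [integrable_prod_iff' (by fun_prop)]
    refine ⟨.of_forall fun x => (hgi.comp_add_right x).abs, ?_⟩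
    have : ∀ x : ℝ, ∫ y : ℝ, ‖|g (y + x)|‖ = ∫ y : ℝ, ‖|g y|‖ := fun x =>
      integral_add_right_eq_self (fun y => ‖|g y|‖) x
    simp only [this]
    exact integrable_const _
  have hind : Integrable ((Set.Icc (-(R + 1)) (R + 1)).indicator (fun _ => (L : ℝ))) :=
    (integrable_indicator_iff measurableSet_Icc).mpr
      (integrableOn_const isCompact_Icc.measure_lt_top.ne)
  refine (((hind.comp_fst M).add hshift).add (hgi.abs.comp_fst M)).mono' ?_
    (.of_forall fun p => abs_diffQuotient_le hg hR' p.1 p.2)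
  have : Measurable g := hgc.measurable
  exact Measurable.aestronglyMeasurable (by fun_prop)

lemma norm_exp_I_mul_ofReal_mul_ofReal (t y : ℝ) : ‖exp (I * t * y)‖ = 1 := by
  rw [show I * (t : ℂ) * y = ((t * y : ℝ) : ℂ) * I by push_cast; ring]
  exact norm_exp_ofReal_mul_I _

/-- Multiplying by a character `y ↦ exp (i t y)` preserves integrability. -/
lemma MeasureTheory.Integrable.mul_exp_I {f : ℝ → ℝ} (hf : Integrable f) (t : ℝ) :
    Integrable (fun y : ℝ => (f y : ℂ) * exp (I * t * y)) :=
  hf.ofReal.mul_bdd (c := 1) (Continuous.aestronglyMeasurable (by fun_prop))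
    (.of_forall fun y => (norm_exp_I_mul_ofReal_mul_ofReal t y).le)

/-- The Fourier transform of a single difference quotient. -/
lemma integral_diffQuotient_mul_exp {g : ℝ → ℝ} (hg : Integrable g) (t x : ℝ) :
    ∫ y : ℝ, (((g (y + x) - g y) / x : ℝ) : ℂ) * exp (I * t * y) =
      (∫ y : ℝ, (g y : ℂ) * exp (I * t * y)) * ((exp (-I * x * t) - 1) / (x : ℂ)) := by
  have hshift : ∫ y : ℝ, (g (y + x) : ℂ) * exp (I * t * y) =
      exp (-I * x * t) * ∫ y : ℝ, (g y : ℂ) * exp (I * t * y) := by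
    rw [← integral_add_right_eq_self (fun y : ℝ => (g y : ℂ) * exp (I * t * y)) x,
      ← integral_const_mul]
    congr 1 with y
    rw [mul_left_comm, ← exp_add]
    push_cast
    ring_nf
  calc ∫ y : ℝ, (((g (y + x) - g y) / x : ℝ) : ℂ) * exp (I * t * y)
      = ∫ y : ℝ, ((g (y + x) : ℂ) * exp (I * t * y) - (g y : ℂ) * exp (I * t * y)) / x := by
        congr 1 with y
        push_cast
        ring
    _ = _ := by
        rw [integral_div, integral_sub ((hg.comp_add_right x).mul_exp_I t) (hg.mul_exp_I t),
          hshift]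
        ring

theorem K_integrable_and_fourier_transform
    (M : Measure ℝ) [IsFiniteMeasure M] (hM0 : M {0} = 0)
    (g : ℝ → ℝ) (L : NNReal) (hg : LipschitzWith L g)
    (hsupp : HasCompactSupport g) :
    Integrable (fun y : ℝ => ∫ x : ℝ, |g (y + x) - g y| / |x| ∂M) ∧
    Integrable (fun y : ℝ => ∫ x : ℝ, (g (y + x) - g y) / x ∂M) ∧
    ∀ t : ℝ,
      (∫ y : ℝ, ((∫ x : ℝ, (g (y + x) - g y) / x ∂M : ℝ) : ℂ) *
          Complex.exp (Complex.I * t * y)) =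
        (∫ y : ℝ, (g y : ℂ) * Complex.exp (Complex.I * t * y)) *
          ∫ x : ℝ, (Complex.exp (-(Complex.I) * x * t) - 1) / (x : ℂ) ∂M := by
  have hF := integrable_diffQuotient_prod M hg hsupp
  refine ⟨?_, hF.integral_prod_left, fun t => ?_⟩
  · simpa only [abs_div] using hF.abs.integral_prod_left
  have hgi : Integrable g := hg.continuous.integrable_of_hasCompactSupport hsupp
  have hFe : Integrable (Function.uncurry fun y x : ℝ =>
      (((g (y + x) - g y) / x : ℝ) : ℂ) * exp (I * t * y)) (volume.prod M) :=
    hF.ofReal.mul_bdd (c := 1) (Continuous.aestronglyMeasurable (by fun_prop))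
      (.of_forall fun p => (norm_exp_I_mul_ofReal_mul_ofReal t p.1).le)
  rw [← integral_const_mul]
  simp_rw [← integral_diffQuotient_mul_exp hgi, ← integral_complex_ofReal, ← integral_mul_const]
  exact integral_integral_swap hFe
end

section
/- Let M be a finite positive Borel measure on ℝ with M({0}) = 0, and define φ(t) = exp( ∫_ℝ (e^{ixt} − 1 − ixt)/x² M(dx) ) for t ∈ ℝ. Then φ is differentiable on ℝ and for every t ∈ ℝ, φ′(t) = i φ(t) · ∫_ℝ (e^{ixt} − 1)/x M(dx). -/
open MeasureTheory Complex

lemma norm_exp_I_mul_sub_one_div_le (x s : ℝ) :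
    ‖I * ((Complex.exp (I * x * s) - 1) / (x : ℂ))‖ ≤ |s| := by
  rcases eq_or_ne x 0 with rfl | hx
  · simp
  · have h := Real.norm_exp_I_mul_ofReal_sub_one_le (x := x * s)
    rw [norm_mul, norm_I, one_mul, norm_div, norm_real, div_le_iff₀ (norm_pos_iff.2 hx)]
    rw [norm_mul, ofReal_mul, ← mul_assoc, mul_comm ‖x‖] at h
    exact h

lemma hasDerivAt_exp_I_mul_sub_one_sub_div_sq (x s : ℝ) :
    HasDerivAt (fun s : ℝ => (Complex.exp (I * x * s) - 1 - I * x * s) / (x : ℂ) ^ 2)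
      (I * ((Complex.exp (I * x * s) - 1) / (x : ℂ))) s := by
  rcases eq_or_ne x 0 with rfl | hx
  · simpa using hasDerivAt_const s (0 : ℂ)
  · have hx' : (x : ℂ) ≠ 0 := ofReal_ne_zero.2 hx
    have hlin : HasDerivAt (fun s : ℝ => I * x * (s : ℂ)) (I * x * 1) s :=
      (ofRealCLM.hasDerivAt (x := s)).const_mul (I * (x : ℂ))
    refine (((hlin.cexp.sub_const 1).sub hlin).div_const ((x : ℂ) ^ 2)).congr_deriv ?_
    field_simp

lemma norm_exp_I_mul_sub_one_sub_div_sq_le (x t : ℝ) :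
    ‖(Complex.exp (I * x * t) - 1 - I * x * t) / (x : ℂ) ^ 2‖ ≤ |t| * |t| := by
  have h := (convex_closedBall (0 : ℝ) |t|).norm_image_sub_le_of_norm_hasDerivWithin_le
    (fun s _ => (hasDerivAt_exp_I_mul_sub_one_sub_div_sq x s).hasDerivWithinAt)
    (C := |t|)
    (fun s hs => (norm_exp_I_mul_sub_one_div_le x s).trans (by simpa using hs))
    (x := 0) (y := t) (by simp) (by simp)
  simpa using h

theorem charFun_infinitely_divisible_hasDerivAt
    (M : Measure ℝ) [IsFiniteMeasure M] (hM0 : M {0} = 0) (t : ℝ) :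
    HasDerivAt
      (fun s : ℝ => Complex.exp (∫ x : ℝ,
        (Complex.exp (Complex.I * x * s) - 1 - Complex.I * x * s) / (x : ℂ) ^ 2 ∂M))
      (Complex.I *
        Complex.exp (∫ x : ℝ,
          (Complex.exp (Complex.I * x * t) - 1 - Complex.I * x * t) / (x : ℂ) ^ 2 ∂M) *
        ∫ x : ℝ, (Complex.exp (Complex.I * x * t) - 1) / (x : ℂ) ∂M)
      t := by
  have hmeas (s : ℝ) : AEStronglyMeasurable
      (fun x : ℝ => (Complex.exp (I * x * s) - 1 - I * x * s) / (x : ℂ) ^ 2) M :=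
    Measurable.aestronglyMeasurable (by fun_prop)
  have hderiv := (hasDerivAt_integral_of_dominated_loc_of_deriv_le (μ := M)
    (bound := fun _ => |t| + 1)
    (F' := fun s x : ℝ => I * ((Complex.exp (I * x * s) - 1) / (x : ℂ)))
    (Metric.ball_mem_nhds t one_pos)
    (Filter.Eventually.of_forall hmeas)
    (.of_bound (hmeas t) (|t| * |t|)
      (.of_forall fun x => norm_exp_I_mul_sub_one_sub_div_sq_le x t))
    (Measurable.aestronglyMeasurable (by fun_prop))
    (.of_forall fun x s hs => (norm_exp_I_mul_sub_one_div_le x s).trans (by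
      rw [Metric.mem_ball, Real.dist_eq] at hs
      linarith [abs_sub_abs_le_abs_sub s t]))
    (integrable_const _)
    (.of_forall fun x s _ => hasDerivAt_exp_I_mul_sub_one_sub_div_sq x s)).2
  convert hderiv.cexp using 1
  rw [integral_const_mul]
  ring
end

section
/- Let b ∈ ℝ, let M be a finite positive Borel measure on ℝ, set σ² = M({0}), and let f be a probability density on ℝ whose characteristic function is f̂(t) = exp( ibt + ∫_ℝ (e^{ixt} − 1 − ixt)/x² M(dx) ). Let g : ℝ → ℝ be Lipschitz and continuously differentiable, and define K(g)(t) := b·g(t) + σ²·g′(t) + ∫_{ℝ∖{0}} (g(t+x) − g(t))/x M(dx). Then for every θ ∈ ℝ, ∫_ℝ K(g)(x+θ) f(x) dx = ∫_ℝ x g(x+θ) f(x) dx. -/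
open MeasureTheory Complex

open Filter Topology Set

/-- The uniform probability measure on the unit interval. -/
noncomputable def unitUniform : Measure ℝ := volume.restrict (Ioc 0 1)

instance : IsProbabilityMeasure unitUniform :=
  ⟨by simp [unitUniform]⟩

section DividedDifference

variable {E : Type*} [NormedAddCommGroup E] [NormedSpace ℝ E] [CompleteSpace E] {G G' : ℝ → E}

theorem smul_integral_unitUniform_deriv (hG : ∀ x, HasDerivAt G (G' x) x) (hG' : Continuous G')
    (x y : ℝ) : y • ∫ u, G' (x + u * y) ∂unitUniform = G (x + y) - G x := by
  have h := intervalIntegral.integral_unitInterval_deriv_eq_sub (𝕜 := ℝ) (f := G) (f' := G')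
    (z₀ := x) (z₁ := y) (by fun_prop) (fun t _ => hG _)
  rw [← h, unitUniform, intervalIntegral.integral_of_le zero_le_one]
  simp only [smul_eq_mul]

/-- The law of `X + U * Y`, for independent `X`, `Y`, `U` with respective laws `μ`, `M` and
uniform on the unit interval. -/
noncomputable def shiftMeasure (μ M : Measure ℝ) : Measure ℝ :=
  ((μ.prod M).prod unitUniform).map fun p => p.1.1 + p.2 * p.1.2

/-- The unnormalised zero bias transform of the law `μ` about the point `b`. -/
noncomputable def zeroBias (μ : Measure ℝ) (b : ℝ) : Measure ℝ :=
  ((μ.withDensity fun x => ENNReal.ofReal ((x - b) ^ 2)).prod unitUniform).map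
    fun p => b + p.2 * (p.1 - b)

instance (μ M : Measure ℝ) [IsFiniteMeasure μ] [IsFiniteMeasure M] :
    IsFiniteMeasure (shiftMeasure μ M) := by
  unfold shiftMeasure; infer_instance

theorem isFiniteMeasure_withDensity_sq {μ : Measure ℝ} [IsFiniteMeasure μ] (hμ : MemLp id 2 μ)
    (b : ℝ) : IsFiniteMeasure (μ.withDensity fun x => ENNReal.ofReal ((x - b) ^ 2)) :=
  isFiniteMeasure_withDensity_ofReal (hμ.sub (memLp_const b)).integrable_sq.2

theorem isFiniteMeasure_zeroBias {μ : Measure ℝ} [IsFiniteMeasure μ] (hμ : MemLp id 2 μ)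
    (b : ℝ) : IsFiniteMeasure (zeroBias μ b) := by
  have := isFiniteMeasure_withDensity_sq hμ b
  unfold zeroBias; infer_instance

theorem integral_zeroBias {μ : Measure ℝ} [IsFiniteMeasure μ] (hμ : MemLp id 2 μ) (b : ℝ)
    (hG : ∀ x, HasDerivAt G (G' x) x) (hG' : Continuous G') {C : ℝ} (hC : ∀ x, ‖G' x‖ ≤ C) :
    ∫ x, G' x ∂zeroBias μ b = ∫ x, (x - b) • (G x - G b) ∂μ := by
  have := isFiniteMeasure_withDensity_sq hμ b
  have hcont : Continuous fun p : ℝ × ℝ => G' (b + p.2 * (p.1 - b)) := by fun_prop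
  rw [zeroBias, integral_map (by fun_prop) hG'.aestronglyMeasurable,
    integral_prod _ (.of_bound hcont.aestronglyMeasurable C (.of_forall fun _ => hC _)),
    integral_withDensity_eq_integral_toReal_smul (by fun_prop) (by simp)]
  refine integral_congr_ae (.of_forall fun x => ?_)
  have h := smul_integral_unitUniform_deriv hG hG' b (x - b)
  rw [add_sub_cancel] at h
  simp only [ENNReal.toReal_ofReal (sq_nonneg (x - b))]
  rw [sq, mul_smul, h]

omit [NormedSpace ℝ E] [CompleteSpace E] in
theorem integrable_shift (μ M : Measure ℝ) [IsFiniteMeasure μ] [IsFiniteMeasure M]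
    (hG' : Continuous G') {C : ℝ} (hC : ∀ x, ‖G' x‖ ≤ C) :
    Integrable (fun p : (ℝ × ℝ) × ℝ => G' (p.1.1 + p.2 * p.1.2)) ((μ.prod M).prod unitUniform) := by
  have hcont : Continuous fun p : (ℝ × ℝ) × ℝ => G' (p.1.1 + p.2 * p.1.2) := by fun_prop
  exact .of_bound hcont.aestronglyMeasurable C (.of_forall fun _ => hC _)

omit [CompleteSpace E] in
theorem integral_shiftMeasure (μ M : Measure ℝ) [IsFiniteMeasure μ] [IsFiniteMeasure M]
    (hG' : Continuous G') {C : ℝ} (hC : ∀ x, ‖G' x‖ ≤ C) :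
    ∫ x, G' x ∂shiftMeasure μ M = ∫ x, ∫ y, ∫ u, G' (x + u * y) ∂unitUniform ∂M ∂μ := by
  have hint := integrable_shift μ M hG' hC
  rw [shiftMeasure, integral_map (by fun_prop) hG'.aestronglyMeasurable,
    integral_prod _ hint, integral_prod _ hint.integral_prod_left]

end DividedDifference

section Kolmogorov

/-- The integrand of the Kolmogorov representation. -/
noncomputable def kolmogorovKernel (t x : ℝ) : ℂ :=
  if x = (0 : ℝ) then -(t : ℂ) ^ 2 / 2 else
    (Complex.exp (Complex.I * x * t) - 1 - Complex.I * x * t) / (x : ℂ) ^ 2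

/-- The divided difference `(exp (I * x * t) - 1) / x`, continuously extended to `x = 0`. -/
noncomputable def expQuotient (t x : ℝ) : ℂ :=
  ∫ u, t * I * Complex.exp (((u * x : ℝ) : ℂ) * t * I) ∂unitUniform

theorem hasDerivAt_exp_mul_I (t x : ℝ) :
    HasDerivAt (fun x : ℝ => Complex.exp (x * t * I)) (t * I * Complex.exp (x * t * I)) x := by
  have h : HasDerivAt (fun x : ℝ => (x : ℂ) * t * I) (t * I) x := by
    simpa using ((hasDerivAt_id x).ofReal_comp.mul_const (t : ℂ)).mul_const I
  simpa [mul_comm] using h.cexp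

theorem norm_exp_mul_mul_I (t x : ℝ) : ‖Complex.exp (x * t * I)‖ = 1 := by
  rw [← ofReal_mul, norm_exp_ofReal_mul_I]

theorem norm_deriv_exp_mul_I_le (t x : ℝ) : ‖(t : ℂ) * I * Complex.exp (x * t * I)‖ ≤ |t| := by
  simp [norm_exp_mul_mul_I]

theorem mul_expQuotient (t x : ℝ) : x * expQuotient t x = Complex.exp (x * t * I) - 1 := by
  have h := smul_integral_unitUniform_deriv (hasDerivAt_exp_mul_I t) (by fun_prop) 0 x
  simpa [expQuotient] using h

theorem expQuotient_zero_right (t : ℝ) : expQuotient t 0 = t * I := by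
  simp [expQuotient]

theorem norm_expQuotient_le (t x : ℝ) : ‖expQuotient t x‖ ≤ |t| := by
  refine (norm_integral_le_of_norm_le_const (.of_forall fun u =>
    norm_deriv_exp_mul_I_le t (u * x))).trans ?_
  simp

theorem measurable_expQuotient (t : ℝ) : Measurable (expQuotient t) := by
  have hcont : Continuous fun p : ℝ × ℝ =>
      (t : ℂ) * I * Complex.exp (((p.2 * p.1 : ℝ) : ℂ) * t * I) := by fun_prop
  exact (hcont.stronglyMeasurable.integral_prod_right' (ν := unitUniform)).measurable

theorem integral_deriv_exp_shiftMeasure (μ M : Measure ℝ) [IsFiniteMeasure μ] [IsFiniteMeasure M]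
    (t : ℝ) : ∫ x : ℝ, t * I * Complex.exp (x * t * I) ∂shiftMeasure μ M =
      charFun μ t * ∫ y, expQuotient t y ∂M := by
  rw [integral_shiftMeasure μ M (by fun_prop) (norm_deriv_exp_mul_I_le t), charFun_apply_real,
    ← integral_mul_const]
  refine integral_congr_ae (.of_forall fun x => ?_)
  simp only [expQuotient, ← integral_const_mul]
  refine integral_congr_ae (.of_forall fun y => integral_congr_ae (.of_forall fun u => ?_))
  simp only [ofReal_add, add_mul, Complex.exp_add]
  rw [mul_comm (t : ℂ) x]
  ring

theorem hasDerivAt_kolmogorovKernel (t x : ℝ) :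
    HasDerivAt (fun t => kolmogorovKernel t x) (I * expQuotient t x) t := by
  by_cases hx : x = 0
  · subst hx
    simp only [kolmogorovKernel, if_true, expQuotient_zero_right]
    have h := (((hasDerivAt_id t).ofReal_comp.pow 2).neg).div_const (2 : ℂ)
    refine h.congr_deriv ?_
    simp only [id_eq, ofReal_one]
    linear_combination (-t : ℂ) * I_mul_I
  · simp only [kolmogorovKernel, if_neg hx]
    have hx' : (x : ℂ) ≠ 0 := by exact_mod_cast hx
    have h0 : HasDerivAt (fun t : ℝ => I * x * (t : ℂ)) (I * x) t := by
      simpa using (hasDerivAt_id t).ofReal_comp.const_mul (I * (x : ℂ))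
    have h := (((h0.cexp).sub_const 1).sub h0).div_const ((x : ℂ) ^ 2)
    refine h.congr_deriv ?_
    have hq := mul_expQuotient t x
    rw [show (x : ℂ) * t * I = I * x * t by ring] at hq
    field_simp
    linear_combination (-1 : ℂ) * hq

theorem norm_kolmogorovKernel_le (t x : ℝ) : ‖kolmogorovKernel t x‖ ≤ t ^ 2 := by
  have h := Convex.norm_image_sub_le_of_norm_hasDerivWithin_le (f := fun t => kolmogorovKernel t x)
    (f' := fun t => I * expQuotient t x) (s := Icc (-|t|) |t|) (C := |t|) (x := 0) (y := t)
    (fun s _ => (hasDerivAt_kolmogorovKernel s x).hasDerivWithinAt)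
    (fun s hs => by simpa using (norm_expQuotient_le s x).trans (abs_le.2 hs))
    (convex_Icc _ _) (by simp) (abs_le.1 le_rfl)
  have h0 : kolmogorovKernel 0 x = 0 := by simp [kolmogorovKernel]
  simpa [h0, abs_mul_abs_self, sq] using h

theorem measurable_kolmogorovKernel (t : ℝ) : Measurable (kolmogorovKernel t) :=
  Measurable.ite (measurableSet_singleton 0) (by fun_prop) (by fun_prop)

variable (M : Measure ℝ) [IsFiniteMeasure M]

theorem hasDerivAt_integral_kolmogorovKernel (t : ℝ) :
    HasDerivAt (fun t => ∫ x, kolmogorovKernel t x ∂M) (I * ∫ x, expQuotient t x ∂M) t := by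
  rw [← integral_const_mul]
  refine (hasDerivAt_integral_of_dominated_loc_of_deriv_le (s := Metric.ball t 1)
    (bound := fun _ => |t| + 1) (Metric.ball_mem_nhds t one_pos)
    (.of_forall fun s => (measurable_kolmogorovKernel s).aestronglyMeasurable)
    (.of_bound (measurable_kolmogorovKernel t).aestronglyMeasurable _
      (.of_forall (norm_kolmogorovKernel_le t)))
    ((measurable_expQuotient t).const_mul I).aestronglyMeasurable
    (.of_forall fun x s hs => ?_) (integrable_const _)
    (.of_forall fun x s _ => hasDerivAt_kolmogorovKernel s x)).2
  have h1 := norm_expQuotient_le s x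
  have h2 := abs_sub_abs_le_abs_sub s t
  rw [Metric.mem_ball, Real.dist_eq] at hs
  simp only [norm_mul, norm_I, one_mul]
  linarith

theorem norm_integral_kolmogorovKernel_le (t : ℝ) :
    ‖∫ x, kolmogorovKernel t x ∂M‖ ≤ t ^ 2 * M.real univ :=
  norm_integral_le_of_norm_le_const (.of_forall (norm_kolmogorovKernel_le t))

end Kolmogorov

section SecondMoment

theorem two_sub_charFun_sub_charFun_neg (μ : Measure ℝ) [IsProbabilityMeasure μ] (t : ℝ) :
    2 - charFun μ t - charFun μ (-t) = ((2 * ∫ x, (1 - Real.cos (t * x)) ∂μ : ℝ) : ℂ) := by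
  have hint (s : ℝ) : Integrable (fun x : ℝ => Complex.exp (s * x * I)) μ :=
    .of_bound (Continuous.aestronglyMeasurable (by fun_prop)) 1 (.of_forall fun x => by
      rw [← ofReal_mul, norm_exp_ofReal_mul_I])
  rw [← integral_const_mul, ← integral_complex_ofReal, charFun_apply_real, charFun_apply_real,
    show (2 : ℂ) = ∫ _, (2 : ℂ) ∂μ by simp, ← integral_sub (integrable_const _) (hint t),
    ← integral_sub (Integrable.sub' (integrable_const _) (hint t)) (hint (-t))]
  refine integral_congr_ae (.of_forall fun x => ?_)
  have h := Complex.two_cos (t * x)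
  push_cast
  rw [mul_sub, h]
  ring_nf

theorem memLp_two_of_charFun {μ : Measure ℝ} [IsProbabilityMeasure μ] {C : ℝ}
    (h : ∀ᶠ t in 𝓝 0, ‖2 - charFun μ t - charFun μ (-t)‖ ≤ C * t ^ 2) : MemLp id 2 μ := by
  have hC : 0 ≤ C := by
    obtain ⟨t, ht, ht0⟩ := ((h.filter_mono nhdsWithin_le_nhds).and
      (self_mem_nhdsWithin (s := {(0 : ℝ)}ᶜ))).exists
    have hpos : 0 < t ^ 2 := by have : t ≠ 0 := ht0; positivity
    exact nonneg_of_mul_nonneg_left ((norm_nonneg _).trans ht) hpos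
  have hu : Tendsto (fun n : ℕ => 1 / ((n : ℝ) + 1)) atTop (𝓝 0) :=
    tendsto_one_div_add_atTop_nhds_zero_nat
  set u : ℕ → ℝ := fun n => 1 / ((n : ℝ) + 1)
  have hu0 (n : ℕ) : 0 < u n := by positivity
  set F : ℕ → ℝ → ENNReal := fun n x =>
    ENNReal.ofReal (Real.pi ^ 2 / 2 * (1 - Real.cos (u n * x)) / u n ^ 2)
  have hlow (x : ℝ) : ENNReal.ofReal (x ^ 2) ≤ liminf (fun n => F n x) atTop := by
    refine le_liminf_of_le (by isBoundedDefault) ?_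
    have hx : Tendsto (fun n => |u n * x|) atTop (𝓝 0) := by
      simpa using (hu.mul_const x).abs
    filter_upwards [hx.eventually_le_const Real.pi_pos] with n hn
    refine ENNReal.ofReal_le_ofReal ?_
    have hcos := Real.cos_le_one_sub_mul_cos_sq hn
    have hpi := Real.pi_pos
    rw [le_div_iff₀ (pow_pos (hu0 n) 2)]
    calc x ^ 2 * u n ^ 2 = Real.pi ^ 2 / 2 * (2 / Real.pi ^ 2 * (u n * x) ^ 2) := by
          field_simp
      _ ≤ _ := by gcongr; linarith
  have hup : ∀ᶠ n in atTop, ∫⁻ x, F n x ∂μ ≤ ENNReal.ofReal (Real.pi ^ 2 / 4 * C) := by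
    filter_upwards [hu.eventually h] with n hn
    have hint : Integrable (fun x => 1 - Real.cos (u n * x)) μ :=
      .of_bound (Continuous.aestronglyMeasurable (by fun_prop)) 2 (.of_forall fun x => by
        rw [Real.norm_eq_abs, abs_le]
        constructor <;> linarith [Real.neg_one_le_cos (u n * x), Real.cos_le_one (u n * x)])
    rw [two_sub_charFun_sub_charFun_neg, norm_real, Real.norm_eq_abs] at hn
    rw [← ofReal_integral_eq_lintegral_ofReal ((hint.const_mul _).div_const _)
      (.of_forall fun x => by
        have := Real.cos_le_one (u n * x)
        exact div_nonneg (mul_nonneg (by positivity) (by linarith)) (by positivity)),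
      integral_div, integral_const_mul]
    refine ENNReal.ofReal_le_ofReal ?_
    rw [div_le_iff₀ (pow_pos (hu0 n) 2)]
    have hpi : 0 ≤ Real.pi ^ 2 / 4 := by positivity
    nlinarith [mul_le_mul_of_nonneg_left ((le_abs_self _).trans hn) hpi]
  have hfin : ∫⁻ x, ENNReal.ofReal (x ^ 2) ∂μ < ⊤ := by
    calc ∫⁻ x, ENNReal.ofReal (x ^ 2) ∂μ ≤ ∫⁻ x, liminf (fun n => F n x) atTop ∂μ :=
          lintegral_mono hlow
      _ ≤ liminf (fun n => ∫⁻ x, F n x ∂μ) atTop := lintegral_liminf_le fun n => by fun_prop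
      _ ≤ ENNReal.ofReal (Real.pi ^ 2 / 4 * C) :=
          liminf_le_of_frequently_le' hup.frequently
      _ < ⊤ := ENNReal.ofReal_lt_top
  refine (memLp_two_iff_integrable_sq (by fun_prop)).2 ⟨by fun_prop, ?_⟩
  rwa [hasFiniteIntegral_iff_ofReal (.of_forall fun x => sq_nonneg _)]

theorem norm_two_sub_exp_sub_exp_le {z w : ℂ} (hz : ‖z‖ ≤ 1) (hw : ‖w‖ ≤ 1) :
    ‖2 - Complex.exp z - Complex.exp w‖ ≤ ‖z + w‖ + ‖z‖ ^ 2 + ‖w‖ ^ 2 := by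
  have h1 := norm_exp_sub_one_sub_id_le hz
  have h2 := norm_exp_sub_one_sub_id_le hw
  have h3 := norm_add₃_le (a := -(z + w)) (b := -(Complex.exp z - 1 - z))
    (c := -(Complex.exp w - 1 - w))
  rw [norm_neg, norm_neg, norm_neg] at h3
  rw [show 2 - Complex.exp z - Complex.exp w = -(z + w) + -(Complex.exp z - 1 - z) +
    -(Complex.exp w - 1 - w) by ring]
  linarith

end SecondMoment

section SteinIdentity

variable {μ M : Measure ℝ} [IsProbabilityMeasure μ] [IsFiniteMeasure M] {b : ℝ}

theorem memLp_two_of_charFun_eq_kolmogorov (h : ∀ t : ℝ, charFun μ t =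
      Complex.exp (I * b * t + ∫ x, kolmogorovKernel t x ∂M)) : MemLp id 2 μ := by
  set ψ : ℝ → ℂ := fun t => ∫ x, kolmogorovKernel t x ∂M
  have hψ (t : ℝ) : ‖ψ t‖ ≤ t ^ 2 * M.real univ := norm_integral_kolmogorovKernel_le M t
  set m := M.real univ
  have hm : 0 ≤ m := measureReal_nonneg
  have hexp (t : ℝ) : ‖I * b * t + ψ t‖ ≤ |b| * |t| + t ^ 2 * m :=
    (norm_add_le _ _).trans (by simpa using hψ t)
  have hsmall : ∀ᶠ t : ℝ in 𝓝 0, |b| * |t| + t ^ 2 * m < 1 := by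
    have : ContinuousAt (fun t : ℝ => |b| * |t| + t ^ 2 * m) 0 := by fun_prop
    exact this.eventually_lt continuousAt_const (by simp)
  refine memLp_two_of_charFun (C := 2 * m + 2 * (|b| + m) ^ 2) ?_
  filter_upwards [hsmall, Metric.ball_mem_nhds (0 : ℝ) one_pos] with t ht ht1
  have ht1 : |t| < 1 := by simpa using ht1
  have h1 := hexp t
  have h2 := hexp (-t)
  rw [abs_neg, neg_sq] at h2
  have hsum : ‖(I * b * t + ψ t) + (I * b * (-t : ℝ) + ψ (-t))‖ ≤ 2 * m * t ^ 2 := by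
    rw [show (I * b * t + ψ t) + (I * b * (-t : ℝ) + ψ (-t)) = ψ t + ψ (-t) by push_cast; ring]
    have h3 := hψ (-t)
    rw [neg_sq] at h3
    linarith [norm_add_le (ψ t) (ψ (-t)), hψ t]
  have hbound : |b| * |t| + t ^ 2 * m ≤ (|b| + m) * |t| := by
    rw [← sq_abs t]
    nlinarith [mul_nonneg hm (abs_nonneg t)]
  have hsq : ((|b| + m) * |t|) ^ 2 = (|b| + m) ^ 2 * t ^ 2 := by rw [mul_pow, sq_abs]
  have h1' := pow_le_pow_left₀ (norm_nonneg _) (h1.trans hbound) 2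
  have h2' := pow_le_pow_left₀ (norm_nonneg _) (h2.trans hbound) 2
  rw [h, h]
  have := norm_two_sub_exp_sub_exp_le (h1.trans ht.le) (h2.trans ht.le)
  linarith

theorem hasDerivAt_charFun {μ : Measure ℝ} [IsFiniteMeasure μ] (hμ : MemLp id 1 μ) (t : ℝ) :
    HasDerivAt (charFun μ) (I * ∫ x : ℝ, x * Complex.exp (x * t * I) ∂μ) t := by
  have hμ' : MemLp id ((1 : ℕ) : ENNReal) μ := by simpa using hμ
  have hd : DifferentiableAt ℝ (charFun μ) t :=
    (contDiff_charFun hμ').differentiable (by simp) t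
  have h := iteratedDeriv_charFun (t := t) hμ'
  rw [iteratedDeriv_one] at h
  refine hd.hasDerivAt.congr_deriv (h.trans ?_)
  simp only [pow_one, mul_comm (t : ℂ)]

theorem integral_sub_mul_exp (hμ : MemLp id 2 μ) (h : ∀ t : ℝ, charFun μ t =
      Complex.exp (I * b * t + ∫ x, kolmogorovKernel t x ∂M)) (t : ℝ) :
    ∫ x : ℝ, ((x : ℂ) - b) * Complex.exp (x * t * I) ∂μ =
      charFun μ t * ∫ y, expQuotient t y ∂M := by
  have h1 := hasDerivAt_charFun (hμ.mono_exponent one_le_two) t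
  have h2 : HasDerivAt (charFun μ) (charFun μ t * (I * b + I * ∫ y, expQuotient t y ∂M)) t := by
    have hb : HasDerivAt (fun t : ℝ => I * b * (t : ℂ)) (I * b) t := by
      simpa using (hasDerivAt_id t).ofReal_comp.const_mul (I * (b : ℂ))
    have h3 := (hb.add (hasDerivAt_integral_kolmogorovKernel M t)).cexp
    rw [h t]
    exact h3.congr_of_eventuallyEq (.of_forall h)
  have heq := h1.unique h2
  have hexp : Integrable (fun x : ℝ => Complex.exp (x * t * I)) μ :=
    .of_bound (Continuous.aestronglyMeasurable (by fun_prop)) 1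
      (.of_forall fun x => (norm_exp_mul_mul_I t x).le)
  have hx : Integrable (fun x : ℝ => (x : ℂ) * Complex.exp (x * t * I)) μ := by
    refine (hμ.integrable one_le_two).mono (Continuous.aestronglyMeasurable (by fun_prop))
      (.of_forall fun x => ?_)
    simp [norm_exp_mul_mul_I]
  have hφ : charFun μ t = ∫ x : ℝ, Complex.exp (x * t * I) ∂μ := by
    simp only [charFun_apply_real, mul_comm (t : ℂ)]
  simp only [sub_mul]
  rw [integral_sub hx (hexp.const_mul _), integral_const_mul, ← hφ]
  refine mul_left_cancel₀ I_ne_zero ?_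
  linear_combination heq

theorem expQuotient_zero_left (x : ℝ) : expQuotient 0 x = 0 := by
  simp [expQuotient]

theorem integral_sub_eq_zero (hμ : MemLp id 2 μ) (h : ∀ t : ℝ, charFun μ t =
      Complex.exp (I * b * t + ∫ x, kolmogorovKernel t x ∂M)) :
    ∫ x : ℝ, (x - b) ∂μ = 0 := by
  have h0 := integral_sub_mul_exp hμ h 0
  simp only [expQuotient_zero_left, integral_zero, mul_zero, ofReal_zero, zero_mul,
    Complex.exp_zero, mul_one] at h0
  rw [← ofReal_inj, ← integral_complex_ofReal]
  simpa using h0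

theorem integral_deriv_eq_ofReal_mul_charFun (ν : Measure ℝ) (t : ℝ) :
    ∫ x : ℝ, t * I * Complex.exp (x * t * I) ∂ν = t * I * charFun ν t := by
  simp only [integral_const_mul, charFun_apply_real, mul_comm (t : ℂ)]

theorem zeroBias_eq_shiftMeasure (hμ : MemLp id 2 μ) (h : ∀ t : ℝ, charFun μ t =
      Complex.exp (I * b * t + ∫ x, kolmogorovKernel t x ∂M)) :
    zeroBias μ b = shiftMeasure μ M := by
  have := isFiniteMeasure_zeroBias hμ b
  have hne (t : ℝ) (ht : t ≠ 0) : charFun (zeroBias μ b) t = charFun (shiftMeasure μ M) t := by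
    have hb := integral_zeroBias hμ b (hasDerivAt_exp_mul_I t) (by fun_prop)
      (norm_deriv_exp_mul_I_le t)
    have hs := integral_deriv_exp_shiftMeasure μ M t
    have hxb : Integrable (fun x : ℝ => x - b) μ :=
      (hμ.integrable one_le_two).sub (integrable_const b)
    have hmul : Integrable (fun x : ℝ => ((x : ℂ) - b) * Complex.exp (x * t * I)) μ := by
      refine hxb.mono (Continuous.aestronglyMeasurable (by fun_prop)) (.of_forall fun x => ?_)
      rw [norm_mul, norm_exp_mul_mul_I, mul_one, ← ofReal_sub, norm_real]
    have hxbc : Integrable (fun x : ℝ => (x : ℂ) - b) μ := by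
      simpa using hxb.ofReal (𝕜 := ℂ)
    have h0 : ∫ x : ℝ, ((x : ℂ) - b) ∂μ = 0 := by
      have := congrArg ((↑) : ℝ → ℂ) (integral_sub_eq_zero hμ h)
      rw [← integral_complex_ofReal] at this
      simpa using this
    simp only [real_smul, ofReal_sub, mul_sub (((_ : ℝ) : ℂ) - _)] at hb
    rw [integral_sub hmul (hxbc.mul_const _), integral_mul_const, h0, zero_mul, sub_zero,
      integral_sub_mul_exp hμ h, ← hs, integral_deriv_eq_ofReal_mul_charFun,
      integral_deriv_eq_ofReal_mul_charFun] at hb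
    exact mul_left_cancel₀ (mul_ne_zero (by exact_mod_cast ht) I_ne_zero) hb
  refine Measure.ext_of_charFun ?_
  exact Continuous.ext_on (dense_compl_singleton (0 : ℝ)) continuous_charFun continuous_charFun hne

theorem integral_sub_mul_eq_integral_shift (hμ : MemLp id 2 μ) (h : ∀ t : ℝ, charFun μ t =
      Complex.exp (I * b * t + ∫ x, kolmogorovKernel t x ∂M)) {G G' : ℝ → ℝ}
    (hG : ∀ x, HasDerivAt G (G' x) x) (hG' : Continuous G') {C : ℝ} (hC : ∀ x, ‖G' x‖ ≤ C)
    (hint : Integrable (fun x => (x - b) * G x) μ) :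
    ∫ x, ∫ y, ∫ u, G' (x + u * y) ∂unitUniform ∂M ∂μ = ∫ x, (x - b) * G x ∂μ := by
  have hxb : Integrable (fun x : ℝ => x - b) μ :=
    (hμ.integrable one_le_two).sub (integrable_const b)
  rw [← integral_shiftMeasure μ M hG' hC, ← zeroBias_eq_shiftMeasure hμ h,
    integral_zeroBias hμ b hG hG' hC]
  simp only [smul_eq_mul, mul_sub (_ - b)]
  rw [integral_sub hint (hxb.mul_const _), integral_mul_const, integral_sub_eq_zero hμ h,
    zero_mul, sub_zero]

theorem integral_divided_difference {G G' : ℝ → ℝ} (M : Measure ℝ) [IsFiniteMeasure M]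
    (hG : ∀ x, HasDerivAt G (G' x) x) (hG' : Continuous G') {C : ℝ} (hC : ∀ x, ‖G' x‖ ≤ C)
    (x : ℝ) : ∫ y, ∫ u, G' (x + u * y) ∂unitUniform ∂M =
      (M {0}).toReal * G' x + ∫ y in ({0}ᶜ : Set ℝ), (G (x + y) - G x) / y ∂M := by
  have hcont : Continuous fun p : ℝ × ℝ => G' (x + p.2 * p.1) := by fun_prop
  have hint : Integrable (fun y => ∫ u, G' (x + u * y) ∂unitUniform) M :=
    (Integrable.of_bound hcont.aestronglyMeasurable C
      (.of_forall fun _ => hC _) : Integrable _ (M.prod unitUniform)).integral_prod_left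
  rw [← integral_add_compl (measurableSet_singleton 0) hint]
  congr 1
  · simp [Measure.real]
  · refine setIntegral_congr_fun (measurableSet_singleton 0).compl fun y hy => ?_
    have hy : y ≠ 0 := hy
    have h := smul_integral_unitUniform_deriv hG hG' x y
    rw [smul_eq_mul] at h
    simp only [← h, mul_div_cancel_left₀ _ hy]

/-- The Stein identity for an infinitely divisible law with finite variance. -/
theorem integral_stein_operator (h : ∀ t : ℝ, charFun μ t =
      Complex.exp (I * b * t + ∫ x, kolmogorovKernel t x ∂M)) {G G' : ℝ → ℝ}
    (hG : ∀ x, HasDerivAt G (G' x) x) (hG' : Continuous G') {C : ℝ} (hC : ∀ x, ‖G' x‖ ≤ C) :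
    ∫ x, (b * G x + (M {0}).toReal * G' x +
      ∫ y in ({0}ᶜ : Set ℝ), (G (x + y) - G x) / y ∂M) ∂μ = ∫ x, x * G x ∂μ := by
  have hμ := memLp_two_of_charFun_eq_kolmogorov h
  have hGcont : Continuous G := continuous_iff_continuousAt.2 fun x => (hG x).continuousAt
  have hGLp : MemLp G 2 μ := by
    refine ((memLp_const |G 0|).add (hμ.norm.const_mul C)).mono hGcont.aestronglyMeasurable
      (.of_forall fun x => ?_)
    have hmvt := convex_univ.norm_image_sub_le_of_norm_hasDerivWithin_le
      (fun x _ => (hG x).hasDerivWithinAt) (fun x _ => hC x) (mem_univ 0) (mem_univ x)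
    rw [sub_zero] at hmvt
    have h1 := norm_sub_norm_le (G x) (G 0)
    refine le_trans ?_ (le_abs_self _)
    simp only [Pi.add_apply, id_eq, ← Real.norm_eq_abs]
    linarith
  have hGint : Integrable G μ := hGLp.integrable one_le_two
  have hxG : Integrable (fun x => x * G x) μ := hμ.integrable_mul hGLp
  have hxbG : Integrable (fun x => (x - b) * G x) μ := by
    simp only [sub_mul]
    exact hxG.sub (hGint.const_mul b)
  have hshift := integral_sub_mul_eq_integral_shift hμ h hG hG' hC hxbG
  have hQ := (integrable_shift μ M hG' hC).integral_prod_left.integral_prod_left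
  simp only [add_assoc, ← integral_divided_difference M hG hG' hC]
  rw [integral_add (hGint.const_mul b) hQ, hshift, ← integral_add (hGint.const_mul b) hxbG]
  exact integral_congr_ae (.of_forall fun x => by ring)

end SteinIdentity

theorem stein_identity_infinitely_divisible_general
    (b : ℝ) (M : Measure ℝ) [IsFiniteMeasure M]
    (f : ℝ → ℝ) (hf_meas : Measurable f) (hf_nonneg : ∀ x, 0 ≤ f x)
    (hf_prob : ∫ x : ℝ, f x = 1)
    (hchar : ∀ t : ℝ,
      (∫ x : ℝ, Complex.exp (Complex.I * x * t) * (f x : ℂ)) =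
        Complex.exp (Complex.I * b * t + ∫ x : ℝ,
          (if x = (0 : ℝ) then -(t : ℂ) ^ 2 / 2 else
            (Complex.exp (Complex.I * x * t) - 1 - Complex.I * x * t) / (x : ℂ) ^ 2) ∂M))
    (g : ℝ → ℝ) (L : NNReal) (hg : LipschitzWith L g) (hg' : ContDiff ℝ 1 g) (θ : ℝ) :
    ∫ x : ℝ,
        (b * g (x + θ) + (M {0}).toReal * deriv g (x + θ) +
          ∫ y in ({0}ᶜ : Set ℝ), (g (x + θ + y) - g (x + θ)) / y ∂M) * f x =
      ∫ x : ℝ, x * g (x + θ) * f x := by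
  have hf_int : Integrable f := integrable_of_integral_eq_one hf_prob
  set μ : Measure ℝ := volume.withDensity fun x => ENNReal.ofReal (f x) with hμ
  have hμ_integral {E : Type} [NormedAddCommGroup E] [NormedSpace ℝ E] (F : ℝ → E) :
      ∫ x, F x ∂μ = ∫ x, f x • F x := by
    rw [hμ, integral_withDensity_eq_integral_toReal_smul (by fun_prop) (by simp)]
    simp only [ENNReal.toReal_ofReal (hf_nonneg _)]
  have : IsProbabilityMeasure μ := ⟨by
    rw [hμ, withDensity_apply _ .univ, setLIntegral_univ,
      ← ofReal_integral_eq_lintegral_ofReal hf_int (.of_forall hf_nonneg), hf_prob,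
      ENNReal.ofReal_one]⟩
  have hφ (t : ℝ) : charFun μ t =
      Complex.exp (I * b * t + ∫ x, kolmogorovKernel t x ∂M) := by
    rw [charFun_apply_real, hμ_integral]
    refine Eq.trans (integral_congr_ae (.of_forall fun x => ?_)) (hchar t)
    simp only [real_smul]
    ring_nf
  have hG (x : ℝ) : HasDerivAt (fun x => g (x + θ)) (deriv g (x + θ)) x :=
    ((hg'.differentiable one_ne_zero) (x + θ)).hasDerivAt.comp_add_const x θ
  have hG' : Continuous fun x => deriv g (x + θ) :=
    (hg'.continuous_deriv le_rfl).comp (continuous_add_const θ)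
  have hstein := integral_stein_operator hφ hG hG' (C := L) fun x => norm_deriv_le_of_lipschitz hg
  rw [hμ_integral, hμ_integral] at hstein
  simpa only [smul_eq_mul, mul_comm (f _), add_right_comm _ _ θ] using hstein
end

section
/- Let t > 0 and let X be a random variable with the Gamma density f_t(x) = e^{−x} x^{t−1}/Γ(t) on (0, ∞). Then for every bounded measurable g : ℝ → ℝ and every θ ∈ ℝ, E[X g(X+θ)] = t · E[ ∫_0^∞ e^{−u} g(X+θ+u) du ]. -/
open MeasureTheory

/-- Exchange of integrals over the region `0 < x < z`, with weight `x ^ (t - 1)`. -/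
lemma integral_rpow_mul_integral_Ioi {t : ℝ} (ht : 0 < t) {G : ℝ → ℝ} (hG : Measurable G)
    (hint : IntegrableOn (fun z => z ^ t * G z) (Set.Ioi 0)) :
    ∫ x in Set.Ioi (0 : ℝ), x ^ (t - 1) * ∫ z in Set.Ioi x, G z =
      ∫ z in Set.Ioi (0 : ℝ), z ^ t / t * G z := by
  have hInt (z : ℝ) : IntegrableOn (fun x : ℝ => x ^ (t - 1)) (Set.Ioo 0 z) := by
    rcases lt_or_ge 0 z with hz | hz
    · rw [← intervalIntegrable_iff_integrableOn_Ioo_of_le hz.le]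
      exact intervalIntegral.intervalIntegrable_rpow' (by linarith)
    · simp [Set.Ioo_eq_empty hz.not_gt]
  have hVal (z : ℝ) (hz : 0 < z) : ∫ x in Set.Ioo 0 z, x ^ (t - 1) = z ^ t / t := by
    rw [← integral_Ioc_eq_integral_Ioo, ← intervalIntegral.integral_of_le hz.le,
      integral_rpow (Or.inl (by linarith))]
    simp [Real.zero_rpow ht.ne']
  set F : ℝ → ℝ → ℝ := fun x z => (Set.Ioo 0 z).indicator (fun x => x ^ (t - 1)) x * G z with hF
  have hF_meas : Measurable (Function.uncurry F) := by
    have h : Function.uncurry F = {p : ℝ × ℝ | 0 < p.1 ∧ p.1 < p.2}.indicator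
        (fun p => p.1 ^ (t - 1) * G p.2) := by
      ext ⟨x, z⟩
      simp [hF, Set.indicator_apply]
    rw [h]
    refine Measurable.indicator (by fun_prop) ?_
    exact (measurableSet_lt measurable_const measurable_fst).inter
      (measurableSet_lt measurable_fst measurable_snd)
  have hF_int : Integrable (Function.uncurry F) (volume.prod volume) := by
    rw [integrable_prod_iff' hF_meas.aestronglyMeasurable]
    refine ⟨.of_forall fun z => ?_, ?_⟩
    · exact ((integrable_indicator_iff measurableSet_Ioo).2 (hInt z)).mul_const (G z)
    · have h : (fun z => ∫ x, ‖Function.uncurry F (x, z)‖) =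
          (Set.Ioi 0).indicator (fun z => ‖z ^ t * G z‖ / t) := by
        ext z
        have hnorm (x : ℝ) : ‖Function.uncurry F (x, z)‖ =
            (Set.Ioo 0 z).indicator (fun x => x ^ (t - 1)) x * |G z| := by
          simp only [Function.uncurry_apply_pair, hF, norm_mul, Real.norm_eq_abs]
          rw [abs_of_nonneg (Set.indicator_nonneg (fun x hx => Real.rpow_nonneg hx.1.le _) x)]
        simp_rw [hnorm]
        rw [integral_mul_const, integral_indicator measurableSet_Ioo]
        rcases lt_or_ge 0 z with hz | hz
        · rw [hVal z hz, Set.indicator_of_mem (Set.mem_Ioi.2 hz), norm_mul, Real.norm_eq_abs,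
            Real.norm_eq_abs, abs_of_nonneg (Real.rpow_nonneg hz.le t)]
          ring
        · simp [hz]
      rw [h, integrable_indicator_iff measurableSet_Ioi]
      exact hint.norm.div_const t
  have hswap := integral_integral_swap hF_int
  have hleft : ∫ x, ∫ z, F x z = ∫ x in Set.Ioi (0 : ℝ), x ^ (t - 1) * ∫ z in Set.Ioi x, G z := by
    rw [← integral_indicator measurableSet_Ioi]
    congr 1 with x
    by_cases hx : 0 < x
    · rw [Set.indicator_of_mem (Set.mem_Ioi.2 hx), ← integral_const_mul,
        ← integral_indicator measurableSet_Ioi]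
      congr 1 with z
      simp [hF, Set.indicator_apply, hx]
    · simp [hF, Set.indicator_apply, hx]
  have hright : ∫ z, ∫ x, F x z = ∫ z in Set.Ioi (0 : ℝ), z ^ t / t * G z := by
    rw [← integral_indicator measurableSet_Ioi]
    congr 1 with z
    simp only [hF]
    rw [integral_mul_const, integral_indicator measurableSet_Ioo]
    rcases lt_or_ge 0 z with hz | hz
    · rw [hVal z hz, Set.indicator_of_mem (Set.mem_Ioi.2 hz)]
    · simp [hz]
  rw [← hleft, hswap, hright]

lemma integral_Ioi_exp_neg_mul_comp_add (g : ℝ → ℝ) (x θ : ℝ) :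
    ∫ u in Set.Ioi (0 : ℝ), Real.exp (-u) * g (x + θ + u) =
      Real.exp x * ∫ z in Set.Ioi x, Real.exp (-z) * g (z + θ) := by
  have h := (measurePreserving_add_left (volume : Measure ℝ) x).setIntegral_preimage_emb
    (measurableEmbedding_addLeft x) (fun z => Real.exp (-z) * g (z + θ)) (Set.Ioi x)
  rw [← h, ← integral_const_mul]
  simp only [Set.preimage_const_add_Ioi, sub_self]
  congr 1 with u
  rw [← mul_assoc, ← Real.exp_add]
  congr 2 <;> ring

lemma integral_comp_eq_of_map_eq_gamma {Ω : Type*} [MeasurableSpace Ω] {P : Measure Ω}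
    {t : ℝ} (ht : 0 < t) {X : Ω → ℝ} (hX_meas : Measurable X)
    (hX_law : Measure.map X P = (volume : Measure ℝ).withDensity
      (fun x => ENNReal.ofReal
        (if 0 < x then Real.exp (-x) * x ^ (t - 1) / Real.Gamma t else 0)))
    {φ : ℝ → ℝ} (hφ : StronglyMeasurable φ) :
    ∫ ω, φ (X ω) ∂P =
      ∫ x in Set.Ioi (0 : ℝ), Real.exp (-x) * x ^ (t - 1) / Real.Gamma t * φ x := by
  rw [← integral_map hX_meas.aemeasurable hφ.aestronglyMeasurable, hX_law,
    integral_withDensity_eq_integral_toReal_smul, ← integral_indicator measurableSet_Ioi]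
  · congr 1 with x
    by_cases hx : 0 < x
    · have := Real.Gamma_pos_of_pos ht
      rw [if_pos hx, Set.indicator_of_mem (Set.mem_Ioi.2 hx), ENNReal.toReal_ofReal (by positivity),
        smul_eq_mul]
    · simp [hx]
  · exact (Measurable.ite measurableSet_Ioi (by fun_prop) measurable_const).ennreal_ofReal
  · simp

theorem stein_identity_gamma
    {Ω : Type*} [MeasurableSpace Ω] (P : Measure Ω) [IsProbabilityMeasure P]
    (t : ℝ) (ht : 0 < t)
    (X : Ω → ℝ) (hX_meas : Measurable X)
    (hX_law : Measure.map X P = (volume : Measure ℝ).withDensity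
      (fun x => ENNReal.ofReal
        (if 0 < x then Real.exp (-x) * x ^ (t - 1) / Real.Gamma t else 0)))
    (g : ℝ → ℝ) (hg_meas : Measurable g) (C : ℝ) (hg_bdd : ∀ x, |g x| ≤ C) (θ : ℝ) :
    ∫ ω, X ω * g (X ω + θ) ∂P =
      t * ∫ ω, (∫ u in Set.Ioi (0 : ℝ), Real.exp (-u) * g (X ω + θ + u)) ∂P := by
  have hint : IntegrableOn (fun z => z ^ t * (Real.exp (-z) * g (z + θ))) (Set.Ioi 0) := by
    have h := Real.GammaIntegral_convergent (s := t + 1) (by linarith)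
    simp only [add_sub_cancel_right] at h
    refine (Integrable.mul_bdd (c := C) h (hg_meas.comp (measurable_add_const θ)).aestronglyMeasurable
      (.of_forall fun z => hg_bdd _)).congr (.of_forall fun z => ?_)
    simp only [Function.comp_apply]
    ring
  have hmeas : StronglyMeasurable
      (fun x => ∫ u in Set.Ioi (0 : ℝ), Real.exp (-u) * g (x + θ + u)) := by
    refine StronglyMeasurable.integral_prod_right (f := fun x u => Real.exp (-u) * g (x + θ + u)) ?_
    exact Measurable.stronglyMeasurable (by fun_prop)
  rw [integral_comp_eq_of_map_eq_gamma ht hX_meas hX_law (φ := fun x => x * g (x + θ))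
      (by fun_prop), integral_comp_eq_of_map_eq_gamma ht hX_meas hX_law hmeas]
  calc
    _ = ∫ z in Set.Ioi (0 : ℝ),
        t / Real.Gamma t * (z ^ t / t * (Real.exp (-z) * g (z + θ))) := by
      refine setIntegral_congr_fun measurableSet_Ioi fun z (hz : 0 < z) => ?_
      rw [Real.rpow_sub_one hz.ne']
      field_simp
    _ = t / Real.Gamma t * ∫ x in Set.Ioi (0 : ℝ), x ^ (t - 1) *
        ∫ z in Set.Ioi x, Real.exp (-z) * g (z + θ) := by
      rw [integral_const_mul, integral_rpow_mul_integral_Ioi ht (by fun_prop) hint]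
    _ = _ := by
      rw [← integral_const_mul, ← integral_const_mul]
      congr 1 with x
      rw [integral_Ioi_exp_neg_mul_comp_add, Real.exp_neg]
      field_simp
end

section
/- Let X be a random variable with the variance-normalized Laplace density f(x) = e^{−√2·|x|}/√2, and set K(x) = −e^{−√2·|x|}·sgn(x). Then for every bounded measurable g : ℝ → ℝ and every θ ∈ ℝ, E[X g(X+θ)] = E[(K*g)(X+θ)], where (K*g)(x) = ∫_ℝ K(x−t) g(t) dt. -/
open MeasureTheory

theorem integrable_exp_neg_mul_abs {a : ℝ} (ha : 0 < a) :
    Integrable (fun x : ℝ => Real.exp (-(a * |x|))) := by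
  rw [← integrableOn_univ, ← Set.Iic_union_Ioi (a := (0 : ℝ))]
  refine IntegrableOn.union ?_ ?_
  · refine (integrableOn_exp_mul_Iic ha 0).congr_fun (fun x hx => ?_) measurableSet_Iic
    simp [abs_of_nonpos (Set.mem_Iic.mp hx)]
  · refine (exp_neg_integrableOn_Ioi 0 ha).congr_fun (fun x hx => ?_) measurableSet_Ioi
    simp [abs_of_pos (Set.mem_Ioi.mp hx)]

theorem measurable_real_sign : Measurable Real.sign := by
  unfold Real.sign
  exact Measurable.ite measurableSet_Iio measurable_const
    (Measurable.ite measurableSet_Ioi measurable_const measurable_const)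

theorem abs_real_sign_le_one (x : ℝ) : |Real.sign x| ≤ 1 := by
  rcases Real.sign_apply_eq x with h | h | h <;> simp [h]

theorem exp_mul_exp_mul_sign_sub_sign (a : ℝ) {u x : ℝ} (hx : x ≠ 0) (hxu : x ≠ u) :
    Real.exp (-(a * |x|)) * Real.exp (-(a * |x - u|)) * (Real.sign (x - u) - Real.sign x)
      = (Set.Ioo 0 u).indicator (fun _ => -2 * Real.exp (-(a * |u|))) x
        + (Set.Ioo u 0).indicator (fun _ => 2 * Real.exp (-(a * |u|))) x := by
  rw [← Real.exp_add]
  rcases lt_or_gt_of_ne hx with h | h <;> rcases lt_or_gt_of_ne hxu with h' | h'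
  · rw [Real.sign_of_neg h, Real.sign_of_neg (by linarith : x - u < 0),
      Set.indicator_of_notMem (by simp; intro; linarith),
      Set.indicator_of_notMem (by simp; intro; linarith)]
    simp
  · rw [Real.sign_of_neg h, Real.sign_of_pos (by linarith : 0 < x - u),
      Set.indicator_of_notMem (by simp; intro; linarith), Set.indicator_of_mem (Set.mem_Ioo.2 ⟨h', h⟩),
      abs_of_neg h, abs_of_pos (by linarith : 0 < x - u), abs_of_neg (h'.trans h)]
    ring_nf
  · rw [Real.sign_of_pos h, Real.sign_of_neg (by linarith : x - u < 0),
      Set.indicator_of_mem (Set.mem_Ioo.2 ⟨h, h'⟩), Set.indicator_of_notMem (by simp; intro; linarith),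
      abs_of_pos h, abs_of_neg (by linarith : x - u < 0), abs_of_pos (h.trans h')]
    ring_nf
  · rw [Real.sign_of_pos h, Real.sign_of_pos (by linarith : 0 < x - u),
      Set.indicator_of_notMem (by simp; intro; linarith),
      Set.indicator_of_notMem (by simp; intro; linarith)]
    simp

theorem integrable_exp_mul_exp_mul_sign {a : ℝ} (ha : 0 < a) (u v : ℝ) :
    Integrable (fun x : ℝ =>
      Real.exp (-(a * |x|)) * Real.exp (-(a * |x - u|)) * Real.sign (x - v)) := by
  have hm : Measurable fun x : ℝ => Real.exp (-(a * |x - u|)) * Real.sign (x - v) := by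
    have := measurable_real_sign.comp (measurable_id.sub_const v)
    exact Measurable.mul (by fun_prop) this
  refine ((integrable_exp_neg_mul_abs ha).mul_bdd (c := 1) hm.aestronglyMeasurable
    (.of_forall fun x => ?_)).congr (.of_forall fun x => ?_)
  · rw [Real.norm_eq_abs, abs_mul, Real.abs_exp]
    refine mul_le_one₀ (Real.exp_le_one_iff.2 ?_) (abs_nonneg _) (abs_real_sign_le_one _)
    have := mul_nonneg ha.le (abs_nonneg (x - u))
    linarith
  · simp only [mul_assoc]

theorem integral_exp_mul_exp_mul_sign {a : ℝ} (ha : 0 < a) (u : ℝ) :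
    ∫ x : ℝ, Real.exp (-(a * |x|)) * Real.exp (-(a * |x - u|)) * Real.sign (x - u)
      = -(u * Real.exp (-(a * |u|))) := by
  have hrefl : ∫ x : ℝ, Real.exp (-(a * |x|)) * Real.exp (-(a * |x - u|)) * Real.sign (x - u)
      = -∫ x : ℝ, Real.exp (-(a * |x|)) * Real.exp (-(a * |x - u|)) * Real.sign x := by
    rw [← integral_sub_left_eq_self _ _ u, ← integral_neg]
    refine integral_congr_ae (.of_forall fun x => ?_)
    simp only
    rw [show u - x - u = -x by ring, abs_neg, abs_sub_comm u x, Real.sign_neg]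
    ring
  have hi := integrable_exp_mul_exp_mul_sign ha u u
  have hi0 := integrable_exp_mul_exp_mul_sign ha u 0
  simp only [sub_zero] at hi0
  have hdiff := integral_sub hi hi0
  have hval : ∫ x : ℝ, (Real.exp (-(a * |x|)) * Real.exp (-(a * |x - u|)) * Real.sign (x - u)
      - Real.exp (-(a * |x|)) * Real.exp (-(a * |x - u|)) * Real.sign x)
      = -2 * (u * Real.exp (-(a * |u|))) := by
    have hae : (fun x : ℝ =>
        Real.exp (-(a * |x|)) * Real.exp (-(a * |x - u|)) * Real.sign (x - u)
        - Real.exp (-(a * |x|)) * Real.exp (-(a * |x - u|)) * Real.sign x) =ᵐ[volume]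
        fun x => (Set.Ioo 0 u).indicator (fun _ => -2 * Real.exp (-(a * |u|))) x
        + (Set.Ioo u 0).indicator (fun _ => 2 * Real.exp (-(a * |u|))) x := by
      filter_upwards [Measure.ae_ne volume (0 : ℝ), Measure.ae_ne volume u] with x hx hxu
      rw [← mul_sub, exp_mul_exp_mul_sign_sub_sign a hx hxu]
    rw [integral_congr_ae hae, integral_add
      ((integrable_indicator_iff measurableSet_Ioo).2 (integrableOn_const (by simp)))
      ((integrable_indicator_iff measurableSet_Ioo).2 (integrableOn_const (by simp))),
      integral_indicator_const _ measurableSet_Ioo, integral_indicator_const _ measurableSet_Ioo]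
    simp only [Real.volume_real_Ioo, smul_eq_mul]
    rcases le_total u 0 with h | h
    · rw [max_eq_right (by linarith), max_eq_left (by linarith)]; ring
    · rw [max_eq_left (by linarith), max_eq_right (by linarith)]; ring
  linarith

theorem integral_exp_mul_integral_exp_sign {a : ℝ} (ha : 0 < a) {g : ℝ → ℝ}
    (hg : Measurable g) {C : ℝ} (hC : ∀ x, |g x| ≤ C) :
    ∫ x : ℝ, Real.exp (-(a * |x|)) *
        ∫ t : ℝ, -(Real.exp (-(a * |x - t|))) * Real.sign (x - t) * g t
      = ∫ x : ℝ, Real.exp (-(a * |x|)) * (x * g x) := by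
  have hint : Integrable (fun p : ℝ × ℝ => Real.exp (-(a * |p.1|)) *
      (-(Real.exp (-(a * |p.1 - p.2|))) * Real.sign (p.1 - p.2) * g p.2))
      (volume.prod volume) := by
    have hconv := ((integrable_exp_neg_mul_abs ha).convolution_integrand
      (ContinuousLinearMap.mul ℝ ℝ) (integrable_exp_neg_mul_abs ha)).swap
    have hm : Measurable fun p : ℝ × ℝ => -(Real.sign (p.1 - p.2) * g p.2) :=
      (measurable_real_sign.comp (measurable_fst.sub measurable_snd)).mul
        (hg.comp measurable_snd) |>.neg
    refine (hconv.mul_bdd (c := C)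
      hm.aestronglyMeasurable (.of_forall fun p => ?_)).congr (.of_forall fun p => ?_)
    · rw [norm_neg, norm_mul, Real.norm_eq_abs, Real.norm_eq_abs]
      calc _ ≤ 1 * C := mul_le_mul (abs_real_sign_le_one _) (hC _) (abs_nonneg _) zero_le_one
        _ = C := one_mul C
    · simp [abs_sub_comm p.2 p.1]
      ring
  simp_rw [← integral_const_mul]
  rw [integral_integral_swap hint]
  refine integral_congr_ae (.of_forall fun t => ?_)
  have h := integral_exp_mul_exp_mul_sign ha t
  calc _ = ∫ x : ℝ, -g t *
        (Real.exp (-(a * |x|)) * Real.exp (-(a * |x - t|)) * Real.sign (x - t)) :=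
        integral_congr_ae (.of_forall fun x => by ring)
    _ = _ := by rw [integral_const_mul, h]; ring

theorem stein_identity_laplace
    {Ω : Type*} [MeasurableSpace Ω] (P : Measure Ω) [IsProbabilityMeasure P]
    (X : Ω → ℝ) (hX_meas : Measurable X)
    (hX_law : Measure.map X P = (volume : Measure ℝ).withDensity
      (fun x => ENNReal.ofReal (Real.exp (-(Real.sqrt 2 * |x|)) / Real.sqrt 2)))
    (K : ℝ → ℝ) (hK : ∀ x, K x = -(Real.exp (-(Real.sqrt 2 * |x|))) * Real.sign x)
    (g : ℝ → ℝ) (hg_meas : Measurable g) (C : ℝ) (hg_bdd : ∀ x, |g x| ≤ C) (θ : ℝ) :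
    ∫ ω, X ω * g (X ω + θ) ∂P = ∫ ω, (∫ s : ℝ, K (X ω + θ - s) * g s) ∂P := by
  have ha : 0 < Real.sqrt 2 := by positivity
  have hlaw : ∀ φ : ℝ → ℝ, Measurable φ → ∫ ω, φ (X ω) ∂P
      = (Real.sqrt 2)⁻¹ * ∫ x, Real.exp (-(Real.sqrt 2 * |x|)) * φ x := by
    intro φ hφ
    rw [← integral_map hX_meas.aemeasurable hφ.aestronglyMeasurable, hX_law,
      integral_withDensity_eq_integral_toReal_smul (by fun_prop)
        (.of_forall fun x => ENNReal.ofReal_lt_top), ← integral_const_mul]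
    refine integral_congr_ae (.of_forall fun x => ?_)
    simp only [smul_eq_mul]
    rw [ENNReal.toReal_ofReal (by positivity)]
    ring
  have hK_meas : Measurable K := by
    rw [funext hK]
    exact Measurable.mul (by fun_prop) measurable_real_sign
  have hKg : Measurable fun x : ℝ => ∫ s : ℝ, K (x + θ - s) * g s :=
    (StronglyMeasurable.integral_prod_right'
      (f := fun p : ℝ × ℝ => K (p.1 + θ - p.2) * g p.2)
      (by fun_prop : Measurable _).stronglyMeasurable).measurable
  rw [hlaw (fun x => x * g (x + θ)) (by fun_prop), hlaw _ hKg,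
    ← integral_exp_mul_integral_exp_sign ha (g := fun x => g (x + θ)) (by fun_prop)
      (fun x => hg_bdd (x + θ))]
  congr 1
  refine integral_congr_ae (.of_forall fun x => ?_)
  simp only
  rw [← integral_add_right_eq_self (fun s => K (x + θ - s) * g s) θ]
  simp only [add_sub_add_right_eq_sub, hK]
end

section
/- Let K(x) = −e^{−√2·|x|}·sgn(x). Then for every x ∈ ℝ the integral (K * (·)₊)(x) = ∫_ℝ K(x−t)·t₊ dt is absolutely convergent and equals h(x), where h(x) = e^{√2·x}/2 for x ≤ 0 and h(x) = 1 − e^{−√2·x}/2 for x > 0. -/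
open MeasureTheory

open Set Filter Topology

/-- The primitive of `t * exp (a * (t - x))`. -/
lemma hasDerivAt_primitive_id_mul_exp {a : ℝ} (ha : a ≠ 0) (x t : ℝ) :
    HasDerivAt (fun t : ℝ => (t / a - 1 / a ^ 2) * Real.exp (a * (t - x)))
      (t * Real.exp (a * (t - x))) t := by
  have h1 : HasDerivAt (fun t : ℝ => t / a - 1 / a ^ 2) (1 / a) t :=
    ((hasDerivAt_id t).div_const a).sub_const _
  have h2 : HasDerivAt (fun t : ℝ => Real.exp (a * (t - x)))
      (Real.exp (a * (t - x)) * (a * 1)) t :=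
    (((hasDerivAt_id t).sub_const x).const_mul a).exp
  refine (h1.mul h2).congr_deriv ?_
  field_simp
  ring

lemma tendsto_primitive_id_mul_exp {a : ℝ} (ha : 0 < a) (x : ℝ) :
    Tendsto (fun t : ℝ => (t / (-a) - 1 / (-a) ^ 2) * Real.exp (-a * (t - x))) atTop (𝓝 0) := by
  have h0 := Real.tendsto_pow_mul_exp_neg_atTop_nhds_zero 0
  have h1 := Real.tendsto_pow_mul_exp_neg_atTop_nhds_zero 1
  have hlin : Tendsto (fun t : ℝ => a * t) atTop atTop := tendsto_id.const_mul_atTop ha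
  have h := (((h1.comp hlin).add (h0.comp hlin)).const_mul (-(Real.exp (a * x) / a ^ 2)))
  simp only [add_zero, mul_zero] at h
  refine h.congr fun t => ?_
  have he : Real.exp (-a * (t - x)) = Real.exp (a * x) * Real.exp (-(a * t)) := by
    rw [← Real.exp_add]; ring_nf
  simp only [Function.comp, he]
  field_simp
  ring

lemma integrableOn_id_mul_exp_Ioi {a c : ℝ} (ha : 0 < a) (hc : 0 ≤ c) (x : ℝ) :
    IntegrableOn (fun t : ℝ => t * Real.exp (-a * (t - x))) (Ioi c) :=
  integrableOn_Ioi_deriv_of_nonneg'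
    (fun t _ => hasDerivAt_primitive_id_mul_exp (neg_ne_zero.2 ha.ne') x t)
    (fun _ ht => mul_nonneg (hc.trans (le_of_lt ht)) (Real.exp_pos _).le)
    (tendsto_primitive_id_mul_exp ha x)

lemma integral_id_mul_exp_Ioi {a c : ℝ} (ha : 0 < a) (hc : 0 ≤ c) (x : ℝ) :
    ∫ t in Ioi c, t * Real.exp (-a * (t - x)) =
      (c / a + 1 / a ^ 2) * Real.exp (-a * (c - x)) := by
  rw [integral_Ioi_of_hasDerivAt_of_tendsto'
    (fun t _ => hasDerivAt_primitive_id_mul_exp (neg_ne_zero.2 ha.ne') x t)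
    (integrableOn_id_mul_exp_Ioi ha hc x) (tendsto_primitive_id_mul_exp ha x)]
  field_simp
  ring

lemma integral_id_mul_exp_Ioc {a c : ℝ} (ha : a ≠ 0) (hc : 0 ≤ c) (x : ℝ) :
    ∫ t in Ioc 0 c, t * Real.exp (a * (t - x)) =
      (c / a - 1 / a ^ 2) * Real.exp (a * (c - x)) + 1 / a ^ 2 * Real.exp (-(a * x)) := by
  rw [← intervalIntegral.integral_of_le hc, intervalIntegral.integral_eq_sub_of_hasDerivAt
    (fun t _ => hasDerivAt_primitive_id_mul_exp ha x t)
    (Continuous.intervalIntegrable (by fun_prop) _ _)]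
  simp

theorem laplace_kernel_convolved_with_positive_part
    (K : ℝ → ℝ) (hK : ∀ x, K x = -(Real.exp (-(Real.sqrt 2 * |x|))) * Real.sign x)
    (h : ℝ → ℝ)
    (hh_le : ∀ x ≤ (0 : ℝ), h x = Real.exp (Real.sqrt 2 * x) / 2)
    (hh_gt : ∀ x > (0 : ℝ), h x = 1 - Real.exp (-(Real.sqrt 2 * x)) / 2)
    (x : ℝ) :
    Integrable (fun t : ℝ => K (x - t) * max t 0) ∧
    ∫ t : ℝ, K (x - t) * max t 0 = h x := by
  have ha : 0 < Real.sqrt 2 := by positivity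
  have hsq : Real.sqrt 2 ^ 2 = 2 := Real.sq_sqrt (by norm_num)
  set a := Real.sqrt 2
  have hc : 0 ≤ max x 0 := le_max_right _ _
  have hae : (fun t : ℝ => K (x - t) * max t 0) =ᵐ[volume] fun t =>
      (Ioi (max x 0)).indicator (fun t => t * Real.exp (-a * (t - x))) t -
      (Ioc 0 (max x 0)).indicator (fun t => t * Real.exp (a * (t - x))) t := by
    filter_upwards [compl_mem_ae_iff.2 (measure_singleton x)] with t ht
    have hne : t ≠ x := ht
    rcases le_or_gt t 0 with h0 | h0
    · simp [h0, h0.not_gt]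
    rcases lt_or_gt_of_ne hne with hx | hx
    · have : 0 < x - t := sub_pos.2 hx
      rw [hK, Real.sign_of_pos this, abs_of_pos this, max_eq_left h0.le,
        indicator_of_notMem (by simp [hx.le]), indicator_of_mem (by simp [h0, hx.le])]
      rw [show -(a * (x - t)) = a * (t - x) by ring]
      ring
    · have : x - t < 0 := sub_neg.2 hx
      rw [hK, Real.sign_of_neg this, abs_of_neg this, max_eq_left h0.le,
        indicator_of_mem (by simp [h0, hx]), indicator_of_notMem (by simp [h0, hx])]
      rw [show -(a * -(x - t)) = -a * (t - x) by ring]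
      ring
  have i1 := (integrableOn_id_mul_exp_Ioi ha hc x).integrable_indicator measurableSet_Ioi
  have i2 : Integrable
      ((Ioc 0 (max x 0)).indicator fun t => t * Real.exp (a * (t - x))) :=
    (Continuous.integrableOn_Ioc (by fun_prop)).integrable_indicator measurableSet_Ioc
  refine ⟨(i1.sub i2).congr hae.symm, ?_⟩
  rw [integral_congr_ae hae, integral_sub i1 i2, integral_indicator measurableSet_Ioi,
    integral_indicator measurableSet_Ioc, integral_id_mul_exp_Ioi ha hc,
    integral_id_mul_exp_Ioc ha.ne' hc, hsq]
  rcases le_or_gt x 0 with h0 | h0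
  · rw [hh_le x h0, max_eq_right h0]
    simp
    ring
  · rw [hh_gt x h0, max_eq_left h0.le]
    simp
    ring
end

section
/- Let X be a random variable with the Laplace density f(x) = e^{−√2·|x|}/√2, let λ > 0, let T^S_λ(x) = sgn(x)·(|x|−λ)₊ be the soft-thresholding function, and let h(x) = e^{√2·x}/2 for x ≤ 0 and h(x) = 1 − e^{−√2·x}/2 for x > 0. Then for every θ ∈ ℝ, E[(T^S_λ(X+θ) − θ)²] = 1 + E[min((X+θ)², λ²)] + 2·E[h(X+θ−λ) − h(X+θ+λ)]. -/
open MeasureTheory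

open Filter Set Topology

/-- The density of the centred Laplace distribution with variance `1`. -/
noncomputable def laplaceDensity (x : ℝ) : ℝ := Real.exp (-(√2 * |x|)) / √2

/-- The distribution function of the centred Laplace distribution with variance `1`. -/
noncomputable def laplaceCDF (x : ℝ) : ℝ :=
  if x ≤ 0 then Real.exp (√2 * x) / 2 else 1 - Real.exp (-(√2 * x)) / 2

lemma laplaceDensity_nonneg (x : ℝ) : 0 ≤ laplaceDensity x := by
  unfold laplaceDensity; positivity

lemma measurable_laplaceDensity : Measurable laplaceDensity := by
  unfold laplaceDensity; fun_prop

lemma measurable_laplaceCDF : Measurable laplaceCDF := by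
  unfold laplaceCDF
  exact Measurable.ite measurableSet_Iic (by fun_prop) (by fun_prop)

lemma laplaceCDF_mem_Icc (x : ℝ) : laplaceCDF x ∈ Icc (0 : ℝ) 1 := by
  unfold laplaceCDF
  split_ifs with hx
  · have : Real.exp (√2 * x) ≤ 1 :=
      Real.exp_le_one_iff.2 (mul_nonpos_of_nonneg_of_nonpos (Real.sqrt_nonneg 2) hx)
    exact ⟨by positivity, by linarith⟩
  · have : Real.exp (-(√2 * x)) ≤ 1 :=
      Real.exp_le_one_iff.2 (neg_nonpos.2 (mul_nonneg (Real.sqrt_nonneg 2) (not_le.1 hx).le))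
    have := Real.exp_pos (-(√2 * x))
    exact ⟨by linarith, by linarith⟩

lemma laplaceCDF_neg (x : ℝ) : laplaceCDF (-x) = 1 - laplaceCDF x := by
  unfold laplaceCDF
  rcases lt_trichotomy x 0 with hx | rfl | hx
  · rw [if_neg (by linarith), if_pos hx.le, mul_neg, neg_neg]
  · norm_num
  · rw [if_pos (by linarith), if_neg (by linarith), mul_neg]; ring

lemma integral_laplaceDensity : ∫ x, laplaceDensity x = 1 := by
  have h2 : (√2) ^ 2 = 2 := Real.sq_sqrt (by norm_num)
  have key := Real.integral_rpow_mul_exp_neg_mul_Ioi (a := 1) (r := √2) (by norm_num) (by positivity)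
  have h := integral_comp_abs (f := fun x : ℝ => Real.exp (-(√2 * x)) / √2)
  unfold laplaceDensity
  rw [h, integral_div]
  simp only [sub_self, Real.rpow_zero, one_mul, Real.rpow_one, Real.Gamma_one, mul_one] at key
  rw [key]
  field_simp
  exact h2.symm

lemma integral_laplaceDensity_mul_sq : ∫ x, laplaceDensity x * x ^ 2 = 1 := by
  have h2 : (√2) ^ 2 = 2 := Real.sq_sqrt (by norm_num)
  have key := Real.integral_rpow_mul_exp_neg_mul_Ioi (a := (2 : ℕ) + 1) (r := √2) (by norm_num)
    (by positivity)
  have h := integral_comp_abs (f := fun x : ℝ => (x ^ 2 * Real.exp (-(√2 * x))) / √2)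
  have h3 : ((2 : ℕ) : ℝ) + 1 = (3 : ℕ) := by norm_num
  rw [Real.Gamma_nat_eq_factorial, add_sub_cancel_right, h3] at key
  simp only [Real.rpow_natCast] at key
  have e : (fun x => laplaceDensity x * x ^ 2) =
      fun x => (|x| ^ 2 * Real.exp (-(√2 * |x|))) / √2 := by
    ext x; unfold laplaceDensity; rw [sq_abs]; ring
  rw [e, h, integral_div, key]
  have h4 : (√2) ^ 4 = 4 := by rw [show (√2) ^ 4 = ((√2) ^ 2) ^ 2 by ring, h2]; norm_num
  have : (Nat.factorial 2 : ℝ) = 2 := by norm_num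
  rw [this]
  field_simp
  linarith

lemma integrable_laplaceDensity_mul {g : ℝ → ℝ} (hg : Measurable g) {C : ℝ}
    (hC : ∀ x, |g x| ≤ C * (1 + x ^ 2)) : Integrable fun x => laplaceDensity x * g x := by
  have h0 : Integrable laplaceDensity :=
    .of_integral_ne_zero (by rw [integral_laplaceDensity]; norm_num)
  have h2 : Integrable fun x => laplaceDensity x * x ^ 2 :=
    .of_integral_ne_zero (by rw [integral_laplaceDensity_mul_sq]; norm_num)
  refine ((h0.add h2).const_mul C).mono'
    (measurable_laplaceDensity.mul hg).aestronglyMeasurable (ae_of_all _ fun x => ?_)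
  rw [Real.norm_eq_abs, abs_mul, abs_of_nonneg (laplaceDensity_nonneg x)]
  calc _ ≤ laplaceDensity x * (C * (1 + x ^ 2)) :=
        mul_le_mul_of_nonneg_left (hC x) (laplaceDensity_nonneg x)
    _ = _ := by simp only [Pi.add_apply]; ring

lemma integrable_laplaceDensity_mul_abs_sub_cdf (a : ℝ) :
    Integrable fun x => laplaceDensity x * (x * |x + a| / 2 - laplaceCDF (x + a) + 1 / 2) := by
  refine integrable_laplaceDensity_mul (C := 2 + |a|) ?_ fun x => ?_
  · have := measurable_laplaceCDF
    fun_prop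
  · have h1 := laplaceCDF_mem_Icc (x + a)
    have h3 : |(x * |x + a|)| ≤ |x| * (|x| + |a|) := by
      rw [abs_mul, abs_abs]
      exact mul_le_mul_of_nonneg_left (abs_add_le x a) (abs_nonneg x)
    have h4 := abs_le.1 h3
    have h5 := sq_abs x
    have h6 : |x| * |a| ≤ (1 + x ^ 2) * |a| :=
      mul_le_mul_of_nonneg_right (by nlinarith [sq_nonneg (|x| - 1)]) (abs_nonneg a)
    have h7 := abs_nonneg a
    have h8 : 0 ≤ x ^ 2 * |a| := by positivity
    rw [abs_le]
    constructor <;> nlinarith [h1.1, h1.2, h4.1, h4.2]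

lemma tendsto_quadratic_mul_exp_neg_atTop {r : ℝ} (hr : 0 < r) (p q s : ℝ) :
    Tendsto (fun x : ℝ => (p * x ^ 2 + q * x + s) * Real.exp (-(r * x))) atTop (𝓝 0) := by
  have h (n : ℕ) : Tendsto (fun x : ℝ => x ^ n * Real.exp (-(r * x))) atTop (𝓝 0) := by
    simpa using tendsto_rpow_mul_exp_neg_mul_atTop_nhds_zero n r hr
  have := (((h 2).const_mul p).add ((h 1).const_mul q)).add ((h 0).const_mul s)
  simp only [mul_zero, add_zero] at this
  refine this.congr fun x => ?_
  ring

lemma hasDerivAt_quadratic_mul_exp (r p q s x : ℝ) :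
    HasDerivAt (fun x : ℝ => (p * x ^ 2 + q * x + s) * Real.exp (r * x))
      ((2 * p * x + q + r * (p * x ^ 2 + q * x + s)) * Real.exp (r * x)) x := by
  have h1 : HasDerivAt (fun x : ℝ => p * x ^ 2 + q * x + s) (2 * p * x + q) x := by
    convert! (((hasDerivAt_pow 2 x).const_mul p).add ((hasDerivAt_id x).const_mul q)).add_const s
      using 1
    simp; ring
  have h2 : HasDerivAt (fun x : ℝ => Real.exp (r * x)) (Real.exp (r * x) * r) x := by
    simpa using ((hasDerivAt_id x).const_mul r).exp
  convert! h1.mul h2 using 1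
  ring

lemma integral_laplaceDensity_mul_abs_sub_cdf_of_nonneg {a : ℝ} (ha : 0 ≤ a) :
    ∫ x, laplaceDensity x * (x * |x + a| / 2 - laplaceCDF (x + a) + 1 / 2) = 0 := by
  have hr : 0 < √2 := by positivity
  have h2 : (√2) ^ 2 = 2 := Real.sq_sqrt (by norm_num)
  have hint := integrable_laplaceDensity_mul_abs_sub_cdf a
  set r := √2 with hr_def
  set f := fun x => laplaceDensity x * (x * |x + a| / 2 - laplaceCDF (x + a) + 1 / 2) with hf
  have hir : 1 / r = r / 2 := by field_simp; exact h2.symm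
  have hdr (x : ℝ) : x / r = x * r / 2 := by rw [div_eq_mul_one_div, hir]; ring
  -- The antiderivatives on the three pieces cut out by the points `-a` and `0`.
  let L : ℝ → ℝ := fun x =>
    -(((1 / 4) * x ^ 2 + (a / 4 - r / 4) * x + (-(a * r / 8))) * Real.exp (r * x)) -
      ((0 * x ^ 2 + 0 * x + Real.exp (r * a) / 8) * Real.exp (2 * r * x))
  let M : ℝ → ℝ := fun x =>
    ((1 / 4) * x ^ 2 + (a / 4 - r / 4) * x + (-(a * r / 8))) * Real.exp (r * x) +
      Real.exp (-(r * a)) * r / 4 * x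
  let R : ℝ → ℝ := fun x =>
    ((-(1 / 4)) * x ^ 2 + (-(a / 4 + r / 4)) * x + (-(a * r / 8))) * Real.exp (-r * x) -
      ((0 * x ^ 2 + 0 * x + Real.exp (-(r * a)) / 8) * Real.exp (-(2 * r) * x))
  have hL : ∫ x in Iic (-a), f x = L (-a) := by
    have hd (x : ℝ) (hx : x ∈ Iic (-a)) : HasDerivAt L (f x) x := by
      have hx : x ≤ -a := hx
      convert! (hasDerivAt_quadratic_mul_exp r (1 / 4) (a / 4 - r / 4) (-(a * r / 8)) x).neg.sub
        (hasDerivAt_quadratic_mul_exp (2 * r) 0 0 (Real.exp (r * a) / 8) x) using 1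
      simp only [hf, laplaceDensity, laplaceCDF]
      rw [← hr_def, if_pos (by linarith), abs_of_nonpos (by linarith : x ≤ 0),
        abs_of_nonpos (by linarith : x + a ≤ 0), hdr, show -(r * -x) = r * x by ring,
        show r * (x + a) = r * x + r * a by ring, show 2 * r * x = r * x + r * x by ring,
        Real.exp_add, Real.exp_add]
      linear_combination (-(Real.exp (r * x) * x / 4 + Real.exp (r * x) * a / 8)) * h2
    have ht : Tendsto L atBot (𝓝 0) := by
      have h1 := (tendsto_quadratic_mul_exp_neg_atTop hr (1 / 4) (-(a / 4 - r / 4))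
        (-(a * r / 8))).comp tendsto_neg_atBot_atTop
      have h3 := (tendsto_quadratic_mul_exp_neg_atTop (by positivity : 0 < 2 * r) 0 0
        (Real.exp (r * a) / 8)).comp tendsto_neg_atBot_atTop
      have h4 := h1.neg.sub h3
      simp only [neg_zero, sub_zero] at h4
      refine h4.congr fun x => ?_
      simp [L]
      ring
    rw [integral_Iic_of_hasDerivAt_of_tendsto' hd hint.integrableOn ht, sub_zero]
  have hM : ∫ x in Ioc (-a) 0, f x = M 0 - M (-a) := by
    have hd (x : ℝ) (hx : x ∈ Ioo (-a) 0) : HasDerivAt M (f x) x := by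
      have hx1 : -a < x := hx.1
      have hx2 : x < 0 := hx.2
      convert! (hasDerivAt_quadratic_mul_exp r (1 / 4) (a / 4 - r / 4) (-(a * r / 8)) x).add
        ((hasDerivAt_id x).const_mul (Real.exp (-(r * a)) * r / 4)) using 1
      simp only [hf, laplaceDensity, laplaceCDF]
      have he : Real.exp (r * x) * Real.exp (-(r * (x + a))) = Real.exp (-(r * a)) := by
        rw [← Real.exp_add]; congr 1; ring
      rw [← hr_def, if_neg (by linarith), abs_of_nonpos hx2.le,
        abs_of_nonneg (by linarith : 0 ≤ x + a), hdr, show -(r * -x) = r * x by ring]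
      linear_combination (Real.exp (r * x) * x / 4 + Real.exp (r * x) * a / 8) * h2 + r / 4 * he
    rw [← intervalIntegral.integral_of_le (by linarith)]
    exact intervalIntegral.integral_eq_sub_of_hasDerivAt_of_le (by linarith)
      (by fun_prop) hd hint.intervalIntegrable
  have hR : ∫ x in Ioi 0, f x = - R 0 := by
    have hd (x : ℝ) (hx : x ∈ Ioi 0) : HasDerivAt R (f x) x := by
      have hx : 0 < x := hx
      convert! (hasDerivAt_quadratic_mul_exp (-r) (-(1 / 4)) (-(a / 4 + r / 4))
        (-(a * r / 8)) x).sub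
        (hasDerivAt_quadratic_mul_exp (-(2 * r)) 0 0 (Real.exp (-(r * a)) / 8) x) using 1
      simp only [hf, laplaceDensity, laplaceCDF]
      rw [← hr_def, if_neg (by linarith), abs_of_nonneg hx.le,
        abs_of_nonneg (by linarith : 0 ≤ x + a), hdr, show -r * x = -(r * x) by ring,
        show -(r * (x + a)) = -(r * x) + -(r * a) by ring,
        show -(2 * r) * x = -(r * x) + -(r * x) by ring, Real.exp_add, Real.exp_add]
      linear_combination (-(Real.exp (-(r * x)) * x / 4 + Real.exp (-(r * x)) * a / 8)) * h2
    have ht : Tendsto R atTop (𝓝 0) := by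
      have h4 := (tendsto_quadratic_mul_exp_neg_atTop hr (-(1 / 4)) (-(a / 4 + r / 4))
        (-(a * r / 8))).sub (tendsto_quadratic_mul_exp_neg_atTop (by positivity : 0 < 2 * r) 0 0
        (Real.exp (-(r * a)) / 8))
      simp only [sub_zero] at h4
      refine h4.congr fun x => ?_
      simp [R]
    have hc : ContinuousWithinAt R (Ici 0) 0 :=
      (by fun_prop : Continuous R).continuousWithinAt
    rw [integral_Ioi_of_hasDerivAt_of_tendsto hc hd hint.integrableOn ht, zero_sub]
  have hsplit : ∫ x in Ioi (-a), f x = (∫ x in Ioc (-a) 0, f x) + ∫ x in Ioi 0, f x := by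
    rw [← setIntegral_union Ioc_disjoint_Ioi_same measurableSet_Ioi hint.integrableOn
      hint.integrableOn, Ioc_union_Ioi_eq_Ioi (by linarith)]
  rw [← intervalIntegral.integral_Iic_add_Ioi (b := -a) hint.integrableOn hint.integrableOn,
    hsplit, hL, hM, hR]
  have he : Real.exp (r * a) * Real.exp (2 * r * -a) = Real.exp (-(r * a)) := by
    rw [← Real.exp_add]; congr 1; ring
  simp only [L, M, R, mul_zero, Real.exp_zero]
  rw [show r * -a = -(r * a) by ring]
  linear_combination (-(1 / 8)) * he

lemma integral_laplaceDensity_mul_abs_sub_cdf (a : ℝ) :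
    ∫ x, laplaceDensity x * (x * |x + a| / 2 - laplaceCDF (x + a) + 1 / 2) = 0 := by
  rcases le_total 0 a with ha | ha
  · exact integral_laplaceDensity_mul_abs_sub_cdf_of_nonneg ha
  · rw [← integral_neg_eq_self, ← neg_eq_zero, ← integral_neg,
      ← integral_laplaceDensity_mul_abs_sub_cdf_of_nonneg (neg_nonneg.2 ha)]
    congr 1
    ext x
    rw [show -x + a = -(x + -a) by ring, laplaceCDF_neg, abs_neg]
    simp only [laplaceDensity, abs_neg]
    ring

lemma integral_comp_eq_integral_laplaceDensity_mul {Ω : Type*} [MeasurableSpace Ω]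
    {P : Measure Ω} {X : Ω → ℝ} (hX : Measurable X)
    (hlaw : P.map X = volume.withDensity fun x => ENNReal.ofReal (laplaceDensity x))
    {g : ℝ → ℝ} (hg : Measurable g) :
    ∫ ω, g (X ω) ∂P = ∫ x, laplaceDensity x * g x := by
  rw [← integral_map hX.aemeasurable hg.aestronglyMeasurable, hlaw,
    integral_withDensity_eq_integral_toReal_smul measurable_laplaceDensity.ennreal_ofReal
      (ae_of_all _ fun x => ENNReal.ofReal_lt_top)]
  simp only [ENNReal.toReal_ofReal (laplaceDensity_nonneg _), smul_eq_mul]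

lemma sign_mul_max_abs_sub_eq {lam : ℝ} (hlam : 0 < lam) (y : ℝ) :
    Real.sign y * max (|y| - lam) 0 = y - (|y + lam| - |y - lam|) / 2 := by
  rcases lt_trichotomy y 0 with hy | rfl | hy
  · rw [Real.sign_of_neg hy]
    grind
  · simp
  · rw [Real.sign_of_pos hy]
    grind

lemma sq_half_abs_add_sub_abs_sub {lam : ℝ} (hlam : 0 < lam) (y : ℝ) :
    ((|y + lam| - |y - lam|) / 2) ^ 2 = min (y ^ 2) (lam ^ 2) := by
  rcases le_total |y| lam with h | h
  · have h' := abs_le.1 h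
    rw [abs_of_nonneg (by linarith [h'.1]), abs_of_nonpos (by linarith [h'.2]),
      min_eq_left (sq_le_sq' h'.1 h'.2)]
    ring
  · have : lam ^ 2 ≤ y ^ 2 := by
      rw [← sq_abs y]; exact pow_le_pow_left₀ hlam.le h 2
    rw [min_eq_right this]
    rcases le_abs.1 h with h | h
    · rw [abs_of_nonneg (by linarith), abs_of_nonneg (by linarith)]; ring
    · rw [abs_of_nonpos (by linarith), abs_of_nonpos (by linarith)]; ring

theorem unbiased_risk_soft_thresholding_laplace
    {Ω : Type*} [MeasurableSpace Ω] (P : Measure Ω) [IsProbabilityMeasure P]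
    (X : Ω → ℝ) (hX_meas : Measurable X)
    (hX_law : Measure.map X P = (volume : Measure ℝ).withDensity
      (fun x => ENNReal.ofReal (Real.exp (-(Real.sqrt 2 * |x|)) / Real.sqrt 2)))
    (lam : ℝ) (hlam : 0 < lam)
    (T : ℝ → ℝ) (hT : ∀ x, T x = Real.sign x * max (|x| - lam) 0)
    (h : ℝ → ℝ)
    (hh_le : ∀ x ≤ (0 : ℝ), h x = Real.exp (Real.sqrt 2 * x) / 2)
    (hh_gt : ∀ x > (0 : ℝ), h x = 1 - Real.exp (-(Real.sqrt 2 * x)) / 2)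
    (θ : ℝ) :
    ∫ ω, (T (X ω + θ) - θ) ^ 2 ∂P =
      1 + (∫ ω, min ((X ω + θ) ^ 2) (lam ^ 2) ∂P) +
        2 * ∫ ω, (h (X ω + θ - lam) - h (X ω + θ + lam)) ∂P := by
  obtain rfl : h = laplaceCDF := by
    ext x
    unfold laplaceCDF
    split_ifs with hx
    · exact hh_le x hx
    · exact hh_gt x (not_le.1 hx)
  obtain rfl : T = fun y => y - (|y + lam| - |y - lam|) / 2 := by
    ext y
    rw [hT, sign_mul_max_abs_sub_eq hlam]
  have hF := measurable_laplaceCDF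
  have hE {g : ℝ → ℝ} (hg : Measurable g) :=
    integral_comp_eq_integral_laplaceDensity_mul hX_meas hX_law hg
  rw [hE (g := fun x => (x + θ - (|x + θ + lam| - |x + θ - lam|) / 2 - θ) ^ 2) (by fun_prop),
    hE (g := fun x => min ((x + θ) ^ 2) (lam ^ 2)) (by fun_prop),
    hE (g := fun x => laplaceCDF (x + θ - lam) - laplaceCDF (x + θ + lam)) (by fun_prop)]
  have i1 : Integrable fun x => laplaceDensity x * x ^ 2 :=
    integrable_laplaceDensity_mul (C := 1) (by fun_prop) fun x => by
      rw [abs_of_nonneg (sq_nonneg x)]; linarith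
  have i2 : Integrable fun x => laplaceDensity x * min ((x + θ) ^ 2) (lam ^ 2) :=
    integrable_laplaceDensity_mul (C := lam ^ 2) (by fun_prop) fun x => by
      rw [abs_of_nonneg (by positivity)]
      exact (min_le_right _ _).trans (by nlinarith [mul_nonneg (sq_nonneg lam) (sq_nonneg x)])
  have i3 : Integrable fun x =>
      laplaceDensity x * (laplaceCDF (x + θ - lam) - laplaceCDF (x + θ + lam)) :=
    integrable_laplaceDensity_mul (C := 1) (by fun_prop) fun x => by
      have h1 := laplaceCDF_mem_Icc (x + θ - lam)
      have h2 := laplaceCDF_mem_Icc (x + θ + lam)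
      rw [abs_le]
      constructor <;> nlinarith [h1.1, h1.2, h2.1, h2.2, sq_nonneg x]
  have i4 := integrable_laplaceDensity_mul_abs_sub_cdf (θ + lam)
  have i5 := integrable_laplaceDensity_mul_abs_sub_cdf (θ - lam)
  have i45 : Integrable fun x =>
      laplaceDensity x * (x * |x + (θ + lam)| / 2 - laplaceCDF (x + (θ + lam)) + 1 / 2) -
      laplaceDensity x * (x * |x + (θ - lam)| / 2 - laplaceCDF (x + (θ - lam)) + 1 / 2) :=
    i4.sub i5
  have e : (fun x => laplaceDensity x *
        (x + θ - (|x + θ + lam| - |x + θ - lam|) / 2 - θ) ^ 2) = fun x =>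
      laplaceDensity x * x ^ 2 + laplaceDensity x * min ((x + θ) ^ 2) (lam ^ 2) +
      2 * (laplaceDensity x * (laplaceCDF (x + θ - lam) - laplaceCDF (x + θ + lam))) -
      2 * (laplaceDensity x *
          (x * |x + (θ + lam)| / 2 - laplaceCDF (x + (θ + lam)) + 1 / 2) -
        laplaceDensity x *
          (x * |x + (θ - lam)| / 2 - laplaceCDF (x + (θ - lam)) + 1 / 2)) := by
    ext x
    rw [← sq_half_abs_add_sub_abs_sub hlam, ← add_assoc, ← add_sub_assoc]
    ring
  rw [e, integral_sub ((i1.fun_add i2).fun_add (i3.const_mul 2)) (i45.const_mul 2),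
    integral_add (i1.fun_add i2) (i3.const_mul 2), integral_add i1 i2, integral_const_mul,
    integral_const_mul, integral_sub i4 i5, integral_laplaceDensity_mul_abs_sub_cdf,
    integral_laplaceDensity_mul_abs_sub_cdf, integral_laplaceDensity_mul_sq]
  ring
end

section
/- Define r(θ) = (1/2)·∫_{−1}^{1} x·(x+θ)₊ dx for θ ∈ ℝ, and let h : ℝ → ℝ be given by h(x) = 0 for x ≤ 0 and, for x > 0, h(x) = −(x − 2⌊x/2⌋)(x − 2⌊x/2⌋ − 2)/2 (the 2-periodic extension to ℝ⁺ of −x(x−2)/2 on [0,2]). Then (i) r(θ) = 0 for θ ≤ −1, r(θ) = 1/6 + θ/4 − θ³/12 for −1 < θ < 1, and r(θ) = 1/3 for θ ≥ 1; and (ii) for every θ ∈ ℝ, (1/2)·∫_{−1}^{1} h(x+θ) dx = r(θ). -/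
open MeasureTheory

theorem integral_quadratic (p q s a b : ℝ) :
    ∫ x in a..b, (p * x ^ 2 + q * x + s) =
      p * (b ^ 3 - a ^ 3) / 3 + q * (b ^ 2 - a ^ 2) / 2 + s * (b - a) := by
  have hd : ∀ x ∈ Set.uIcc a b,
      HasDerivAt (fun x : ℝ => p * x ^ 3 / 3 + q * x ^ 2 / 2 + s * x)
        (p * x ^ 2 + q * x + s) x := by
    intro x _
    have := ((((hasDerivAt_pow 3 x).const_mul p).div_const 3).add
      (((hasDerivAt_pow 2 x).const_mul q).div_const 2)).add ((hasDerivAt_id x).const_mul s)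
    refine (this.congr_deriv ?_).congr_of_eventuallyEq (.of_forall fun y => ?_)
    · norm_num
      ring
    · simp [mul_div_assoc]
  rw [intervalIntegral.integral_eq_sub_of_hasDerivAt hd
    (Continuous.intervalIntegrable (by fun_prop) _ _)]
  ring

theorem integral_eq_of_eqOn_quadratic {f : ℝ → ℝ} {a b : ℝ} (p q s : ℝ) (hab : a ≤ b)
    (hf : ∀ x, a ≤ x → x ≤ b → f x = p * x ^ 2 + q * x + s) :
    ∫ x in a..b, f x =
      p * (b ^ 3 - a ^ 3) / 3 + q * (b ^ 2 - a ^ 2) / 2 + s * (b - a) := by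
  rw [← integral_quadratic]
  refine intervalIntegral.integral_congr fun x hx => ?_
  rw [Set.uIcc_of_le hab] at hx
  exact hf x hx.1 hx.2

theorem intervalIntegrable_of_eqOn_quadratic {f : ℝ → ℝ} {a b : ℝ} (p q s : ℝ) (hab : a ≤ b)
    (hf : ∀ x, a ≤ x → x ≤ b → f x = p * x ^ 2 + q * x + s) :
    IntervalIntegrable f volume a b := by
  have hg : IntervalIntegrable (fun x : ℝ => p * x ^ 2 + q * x + s) volume a b :=
    Continuous.intervalIntegrable (by fun_prop) _ _
  refine hg.congr fun x hx => ?_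
  rw [Set.uIoc_of_le hab] at hx
  exact (hf x hx.1.le hx.2).symm

theorem integral_eq_of_piecewise_quadratic {f : ℝ → ℝ} {a b c : ℝ} (p q s p' q' s' : ℝ)
    (hac : a ≤ c) (hcb : c ≤ b)
    (hf : ∀ x, a ≤ x → x ≤ c → f x = p * x ^ 2 + q * x + s)
    (hf' : ∀ x, c ≤ x → x ≤ b → f x = p' * x ^ 2 + q' * x + s') :
    ∫ x in a..b, f x =
      (p * (c ^ 3 - a ^ 3) / 3 + q * (c ^ 2 - a ^ 2) / 2 + s * (c - a)) +
      (p' * (b ^ 3 - c ^ 3) / 3 + q' * (b ^ 2 - c ^ 2) / 2 + s' * (b - c)) := by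
  rw [← intervalIntegral.integral_add_adjacent_intervals
      (intervalIntegrable_of_eqOn_quadratic p q s hac hf)
      (intervalIntegrable_of_eqOn_quadratic p' q' s' hcb hf'),
    integral_eq_of_eqOn_quadratic p q s hac hf, integral_eq_of_eqOn_quadratic p' q' s' hcb hf']

theorem periodic_parabola_eq {x : ℝ} {n : ℤ} (h₁ : 2 * (n : ℝ) ≤ x) (h₂ : x ≤ 2 * n + 2) :
    -((x - 2 * (⌊x / 2⌋ : ℝ)) * (x - 2 * (⌊x / 2⌋ : ℝ) - 2)) / 2 =
      -((x - 2 * (n : ℝ)) * (x - 2 * n - 2)) / 2 := by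
  rcases h₂.lt_or_eq with h | h
  · have hfl : ⌊x / 2⌋ = n := Int.floor_eq_iff.2 ⟨by linarith, by linarith⟩
    rw [hfl]
  · have hfl : ⌊x / 2⌋ = n + 1 := by
      rw [Int.floor_eq_iff]
      push_cast
      exact ⟨by linarith, by linarith⟩
    rw [hfl, h]
    push_cast
    ring



theorem uniform_density_risk_representation
    (r : ℝ → ℝ)
    (hr : ∀ θ : ℝ, r θ = (1 / 2) * ∫ x in (-1 : ℝ)..1, x * max (x + θ) 0)
    (h : ℝ → ℝ)
    (hh_le : ∀ x ≤ (0 : ℝ), h x = 0)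
    (hh_gt : ∀ x > (0 : ℝ), h x =
      -((x - 2 * (⌊x / 2⌋ : ℝ)) * (x - 2 * (⌊x / 2⌋ : ℝ) - 2)) / 2) :
    ((∀ θ : ℝ, θ ≤ -1 → r θ = 0) ∧
     (∀ θ : ℝ, -1 < θ → θ < 1 → r θ = 1 / 6 + θ / 4 - θ ^ 3 / 12) ∧
     (∀ θ : ℝ, 1 ≤ θ → r θ = 1 / 3)) ∧
    (∀ θ : ℝ, (1 / 2) * ∫ x in (-1 : ℝ)..1, h (x + θ) = r θ) := by
  have hr₁ : ∀ θ : ℝ, θ ≤ -1 → r θ = 0 := by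
    intro θ hθ
    rw [hr, integral_eq_of_eqOn_quadratic 0 0 0 (by norm_num)]
    · ring
    · intro x _ hx
      rw [max_eq_right (by linarith)]
      ring
  have hr₂ : ∀ θ : ℝ, -1 < θ → θ < 1 → r θ = 1 / 6 + θ / 4 - θ ^ 3 / 12 := by
    intro θ hθ hθ'
    rw [hr, integral_eq_of_piecewise_quadratic (c := -θ) 0 0 0 1 θ 0 (by linarith) (by linarith)]
    · ring
    · intro x _ hx
      rw [max_eq_right (by linarith)]
      ring
    · intro x hx _
      rw [max_eq_left (by linarith)]
      ring
  have hr₃ : ∀ θ : ℝ, 1 ≤ θ → r θ = 1 / 3 := by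
    intro θ hθ
    rw [hr, integral_eq_of_eqOn_quadratic 1 θ 0 (by norm_num)]
    · ring
    · intro x hx _
      rw [max_eq_left (by linarith)]
      ring
  have hh : ∀ (n : ℤ) (x : ℝ), 0 ≤ n → 2 * (n : ℝ) ≤ x → x ≤ 2 * n + 2 →
      h x = -((x - 2 * (n : ℝ)) * (x - 2 * n - 2)) / 2 := by
    intro n x hn h₁ h₂
    have hn' : (0 : ℝ) ≤ n := by exact_mod_cast hn
    rcases le_or_gt x 0 with hx | hx
    · have hx0 : x = 0 := by linarith
      have hn0 : (n : ℝ) = 0 := by linarith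
      rw [hh_le x hx, hn0, hx0]
      ring
    · rw [hh_gt x hx, periodic_parabola_eq h₁ h₂]
  refine ⟨⟨hr₁, hr₂, hr₃⟩, fun θ => ?_⟩
  rw [intervalIntegral.integral_comp_add_right]
  rcases le_or_gt θ (-1) with hθ | hθ
  · rw [hr₁ θ hθ, integral_eq_of_eqOn_quadratic 0 0 0 (by linarith)]
    · ring
    · intro x _ hx
      rw [hh_le x (by linarith)]
      ring
  rcases lt_or_ge θ 1 with hθ' | hθ'
  · rw [hr₂ θ hθ hθ', integral_eq_of_piecewise_quadratic (c := 0) 0 0 0 (-1 / 2) 1 0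
      (by linarith) (by linarith)]
    · ring
    · intro x _ hx
      rw [hh_le x hx]
      ring
    · intro x hx hx'
      rw [hh 0 x le_rfl (by simpa using hx) (by push_cast; linarith)]
      push_cast
      ring
  · obtain ⟨n, hn⟩ : ∃ n : ℤ, ⌊(θ - 1) / 2⌋ = n := ⟨_, rfl⟩
    have hn0 : 0 ≤ n := hn ▸ Int.floor_nonneg.2 (by linarith)
    obtain ⟨h₁, h₂⟩ := Int.floor_eq_iff.1 hn
    rw [hr₃ θ hθ', integral_eq_of_piecewise_quadratic (c := 2 * (n : ℝ) + 2)
      (-1 / 2) (2 * n + 1) (-(2 * n * (2 * n + 2)) / 2)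
      (-1 / 2) (2 * n + 3) (-((2 * n + 2) * (2 * n + 4)) / 2) (by linarith) (by linarith)]
    · ring
    · intro x hx hx'
      rw [hh n x hn0 (by linarith) hx']
      ring
    · intro x hx hx'
      rw [hh (n + 1) x (by omega) (by push_cast; linarith) (by push_cast; linarith)]
      push_cast
      ring
end
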